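/- arXiv:2402.08422 — 3 statements merged into one kernel-verified Lean document; each statement's English description precedes it below -/
import Mathlib

section
/- Let p = (p_i)_{i∈ℕ} be a probability distribution on ℕ, X^n a sample of n ≥ 2 i.i.d. observations from p, and p̂ the maximum likelihood estimator. Let δ₁ > 0, δ₂ > 0, and let m be a positive even integer. Then with probability at least 1 − δ₁ − δ₂, sup_{i∈ℕ} |p_i − p̂_i(X^n)| ≤ (m/δ₁^{1/m})·(1/n)·( Σ_{k=1}^{m/2} Σ_{i∈ℕ} (n·p̂_i(1−p̂_i))^k )^{1/m} + a·(m/δ₁^{1/m})·(log(1/δ₂))^{1/(2m)}·( n^{−(1/2)(1+1/m)} + 24·n^{−(1/2)(1+5/m)} ), where a = √(2·exp(1/e)). -/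
open MeasureTheory Real Filter

noncomputable def sampleMeasure (p : PMF ℕ) (n : ℕ) : Measure (Fin n → ℕ) :=
  MeasureTheory.Measure.pi fun _ => p.toMeasure

noncomputable def mle (n : ℕ) (x : Fin n → ℕ) (i : ℕ) : ℝ :=
  ((Finset.univ.filter fun j => x j = i).card : ℝ) / n

instance sampleMeasure_prob (p : PMF ℕ) (n : ℕ) : IsProbabilityMeasure (sampleMeasure p n) := by
  unfold sampleMeasure; infer_instance

/-- asymmetric kernel -/
noncomputable def Ker (g : ℕ → ℝ) (a b : ℕ) : ℝ := if a = b then 0 else g a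

lemma sample_indep (p : PMF ℕ) (n : ℕ) :
    ProbabilityTheory.iIndepFun (fun (i : Fin n) (x : Fin n → ℕ) => x i) (sampleMeasure p n) := by
  unfold sampleMeasure
  exact ProbabilityTheory.iIndepFun_pi (X := fun _ => id) (fun _ => aemeasurable_id)

lemma sample_map_eval (p : PMF ℕ) (n : ℕ) (i : Fin n) :
    (sampleMeasure p n).map (fun x => x i) = p.toMeasure := by
  unfold sampleMeasure
  exact (measurePreserving_eval (fun _ : Fin n => p.toMeasure) i).map_eq

lemma pmf_le_one (p : PMF ℕ) (i : ℕ) : (p i).toReal ≤ 1 := by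
  have := ENNReal.toReal_mono ENNReal.one_ne_top (p.coe_le_one i)
  simpa using this

lemma pmf_real (p : PMF ℕ) (i : ℕ) : p.toMeasure.real {i} = (p i).toReal := by
  rw [measureReal_def, PMF.toMeasure_apply_singleton _ _ (MeasurableSet.of_discrete)]

lemma integrable_bdd {α : Type*} [MeasurableSpace α] [DiscreteMeasurableSpace α] [Countable α]
    (μ : Measure α) [IsFiniteMeasure μ] (f : α → ℝ) (b : ℝ) (h : ∀ a, |f a| ≤ b) :
    Integrable f μ := by
  refine Integrable.of_bound (C := b) ?_ (Eventually.of_forall fun a => by simpa using h a)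
  exact (Measurable.of_discrete).aestronglyMeasurable

lemma integral_Ker (p : PMF ℕ) (n : ℕ) (g : ℕ → ℝ) (b : ℝ) (hg : ∀ i, 0 ≤ g i) (hgb : ∀ i, g i ≤ b)
    (i j : Fin n) (hij : i ≠ j) :
    ∫ x, Ker g (x i) (x j) ∂(sampleMeasure p n)
      = ∑' k, g k * ((p k).toReal * (1 - (p k).toReal)) := by
  have hb : 0 ≤ b := (hg 0).trans (hgb 0)
  have hind := (sample_indep p n).indepFun hij
  have hmap : (sampleMeasure p n).map (fun x => (x i, x j)) = p.toMeasure.prod p.toMeasure := by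
    rw [ProbabilityTheory.IndepFun.map_prod_eq_prod_map_map (Measurable.of_discrete.aemeasurable)
      (Measurable.of_discrete.aemeasurable) hind,
      sample_map_eval, sample_map_eval]
  have h1 : ∫ x, Ker g (x i) (x j) ∂(sampleMeasure p n)
      = ∫ z : ℕ × ℕ, Ker g z.1 z.2 ∂(p.toMeasure.prod p.toMeasure) := by
    rw [← hmap, integral_map (by fun_prop)
      (Measurable.of_discrete).aestronglyMeasurable]
  have hK : ∀ z : ℕ × ℕ, |Ker g z.1 z.2| ≤ b := by
    intro z; unfold Ker; split_ifs
    · simpa using hb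
    · rw [abs_of_nonneg (hg _)]; exact hgb _
  rw [h1, integral_prod _ (integrable_bdd _ _ b hK)]
  have h2 : ∀ x : ℕ, ∫ y, Ker g x y ∂p.toMeasure = g x * (1 - (p x).toReal) := by
    intro x
    have : (fun y => Ker g x y) = fun y => g x - Set.indicator {x} (fun _ => g x) y := by
      funext y; unfold Ker
      by_cases h : x = y
      · subst h; simp
      · simp [h, Set.indicator, Ne.symm h]
    rw [this, integral_sub (integrable_const _) ((integrable_const _).indicator .of_discrete),
      integral_indicator_const _ (.of_discrete), pmf_real]
    simp; ring
  simp only [h2]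
  rw [PMF.integral_eq_tsum]
  · refine tsum_congr fun k => ?_
    simp [smul_eq_mul]; ring
  · refine integrable_bdd _ _ b fun a => ?_
    have := pmf_le_one p a
    have h0 : 0 ≤ (p a).toReal := ENNReal.toReal_nonneg
    rw [abs_of_nonneg (mul_nonneg (hg a) (by linarith))]
    calc g a * (1 - (p a).toReal) ≤ g a * 1 := by gcongr; exact hg a; linarith
      _ ≤ b := by simpa using hgb a

open ProbabilityTheory in
lemma subG_pair (p : PMF ℕ) (n : ℕ) (g : ℕ → ℝ) (b : NNReal) (hg : ∀ i, 0 ≤ g i) (hgb : ∀ i, g i ≤ b)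
    (i j : Fin n) (hij : i ≠ j) :
    HasSubgaussianMGF (fun x : Fin n → ℕ =>
      (∑' k, g k * ((p k).toReal * (1 - (p k).toReal))) - Ker g (x i) (x j))
      ((b / 2) ^ 2) (sampleMeasure p n) := by
  have h := hasSubgaussianMGF_of_mem_Icc (μ := sampleMeasure p n) (a := -(b:ℝ)) (b := 0)
    (X := fun x : Fin n → ℕ => - Ker g (x i) (x j)) (Measurable.of_discrete).aemeasurable
    (Eventually.of_forall fun x => by
      unfold Ker; split_ifs
      · simp
      · simp [hg, hgb])
  rw [integral_neg, integral_Ker p n g b hg hgb i j hij] at h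
  convert! h using 1
  · funext x; ring
  · simp

open ProbabilityTheory in
lemma subG_match (p : PMF ℕ) (n N : ℕ) (F : ℕ → ℕ → ℝ) (c : NNReal) (a b : Fin N → Fin n)
    (ha : a.Injective) (hb : b.Injective) (hab : ∀ l l', a l ≠ b l')
    (hs : ∀ i j : Fin n, i ≠ j → HasSubgaussianMGF (fun x : Fin n → ℕ => F (x i) (x j)) c
      (sampleMeasure p n)) (s : Finset (Fin N)) :
    HasSubgaussianMGF (fun x : Fin n → ℕ => ∑ l ∈ s, F (x (a l)) (x (b l))) (s.card * c)
      (sampleMeasure p n) := by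
  classical
  induction s using Finset.induction_on with
  | empty => simp
  | insert l s hl ih =>
    rw [Finset.card_insert_of_notMem hl]
    have hS := (sample_indep p n).indepFun_finset {a l, b l} (s.image a ∪ s.image b) (by
      rw [Finset.disjoint_left]
      intro i hi
      simp only [Finset.mem_insert, Finset.mem_singleton] at hi
      simp only [Finset.mem_union, Finset.mem_image, not_or, not_exists, not_and]
      rcases hi with rfl | rfl
      · exact ⟨fun k hk h => hl (ha h ▸ hk), fun k hk h => hab _ _ h.symm⟩
      · exact ⟨fun k hk h => hab _ _ h, fun k hk h => hl (hb h ▸ hk)⟩) (by fun_prop)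
    have hI : IndepFun (fun x : Fin n → ℕ => F (x (a l)) (x (b l)))
        (fun x : Fin n → ℕ => ∑ l ∈ s, F (x (a l)) (x (b l))) (sampleMeasure p n) := by
      have := hS.comp
        (φ := fun y => F (y ⟨a l, by simp⟩) (y ⟨b l, by simp⟩))
        (ψ := fun y => ∑ k ∈ s.attach, F (y ⟨a k.1, by
            simp only [Finset.mem_union, Finset.mem_image]; exact Or.inl ⟨k.1, k.2, rfl⟩⟩)
          (y ⟨b k.1, by
            simp only [Finset.mem_union, Finset.mem_image]; exact Or.inr ⟨k.1, k.2, rfl⟩⟩))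
        Measurable.of_discrete Measurable.of_discrete
      convert this using 1
      simp only [Function.comp_def]
      funext x
      exact (Finset.sum_attach s (fun k => F (x (a k)) (x (b k)))).symm
    have := (hs (a l) (b l) (hab _ _)).add_of_indepFun ih hI
    convert! this using 1
    · funext x; rw [Finset.sum_insert hl]
    · push_cast; ring

open ProbabilityTheory in
lemma subG_sum {Ω ι : Type*} [MeasurableSpace Ω] (μ : Measure Ω) [IsProbabilityMeasure μ]
    (X : ι → Ω → ℝ) (c : NNReal) (h : ∀ i, HasSubgaussianMGF (X i) c μ) (s : Finset ι) :
    HasSubgaussianMGF (fun ω => ∑ i ∈ s, X i ω) (s.card ^ 2 * c) μ := by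
  classical
  induction s using Finset.induction_on with
  | empty => simp
  | insert l s hl ih =>
    have := (h l).add ih
    convert! this using 1
    · funext x; rw [Finset.sum_insert hl]
    · rw [Finset.card_insert_of_notMem hl, NNReal.sqrt_mul, NNReal.sqrt_sq]
      have : NNReal.sqrt c + s.card * NNReal.sqrt c = (s.card + 1) * NNReal.sqrt c := by ring
      rw [this, mul_pow, NNReal.sq_sqrt]; push_cast; ring

lemma perm_sum (n : ℕ) (f : Fin n → Fin n → ℝ) (hf : ∀ i, f i i = 0) (a b : Fin n) (hab : a ≠ b) :
    (n * (n - 1) : ℝ) * ∑ σ : Equiv.Perm (Fin n), f (σ a) (σ b)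
      = (n.factorial : ℝ) * ∑ i, ∑ j, f i j := by
  classical
  set A := ∑ σ : Equiv.Perm (Fin n), f (σ a) (σ b) with hA
  have key : ∀ i j : Fin n, ∑ σ : Equiv.Perm (Fin n), f (σ i) (σ j) = if i = j then 0 else A := by
    intro i j
    split_ifs with h
    · subst h; simp [hf]
    · obtain ⟨τ, h1, h2⟩ : ∃ τ : Equiv.Perm (Fin n), τ a = i ∧ τ b = j := by
        refine ⟨Equiv.swap (Equiv.swap a i b) j * Equiv.swap a i, ?_, ?_⟩
        · rw [Equiv.Perm.mul_apply, Equiv.swap_apply_left]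
          apply Equiv.swap_apply_of_ne_of_ne _ h
          intro h'
          have : Equiv.swap a i a = Equiv.swap a i b := by rw [Equiv.swap_apply_left]; exact h'
          exact hab ((Equiv.swap a i).injective this)
        · rw [Equiv.Perm.mul_apply, Equiv.swap_apply_left]
      have := Equiv.sum_comp (Equiv.mulRight τ) (fun σ : Equiv.Perm (Fin n) => f (σ a) (σ b))
      rw [hA, ← this]
      simp [h1, h2]
  have h1 : ∑ i : Fin n, ∑ j : Fin n, ∑ σ : Equiv.Perm (Fin n), f (σ i) (σ j)
      = (n.factorial : ℝ) * ∑ i, ∑ j, f i j := by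
    have : ∀ σ : Equiv.Perm (Fin n), ∑ i : Fin n, ∑ j : Fin n, f (σ i) (σ j) = ∑ i, ∑ j, f i j := by
      intro σ
      rw [← Equiv.sum_comp σ (fun i => ∑ j, f i j)]
      exact Finset.sum_congr rfl fun i _ => Equiv.sum_comp σ (fun j => f (σ i) j)
    calc _ = ∑ i : Fin n, ∑ σ : Equiv.Perm (Fin n), ∑ j : Fin n, f (σ i) (σ j) :=
          Finset.sum_congr rfl fun i _ => Finset.sum_comm
      _ = ∑ σ : Equiv.Perm (Fin n), ∑ i : Fin n, ∑ j : Fin n, f (σ i) (σ j) := Finset.sum_comm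
      _ = _ := by
        rw [Finset.sum_congr rfl fun σ _ => this σ]
        simp [Fintype.card_perm]
  rw [← h1]
  simp only [key]
  have : ∀ i : Fin n, (∑ j : Fin n, if i = j then (0:ℝ) else A) = (n - 1) * A := by
    intro i
    have : ∀ j : Fin n, (if i = j then (0:ℝ) else A) = A - if i = j then A else 0 := by
      intro j; split_ifs <;> simp
    simp only [this, Finset.sum_sub_distrib]
    simp; ring
  simp only [this]
  simp; ring

open ProbabilityTheory in
/-- Hoeffding for the U-statistic -/
lemma ustat (p : PMF ℕ) (n : ℕ) (hn : 2 ≤ n) (g : ℕ → ℝ) (b : NNReal) (hb : 0 < b)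
    (hg : ∀ i, 0 ≤ g i) (hgb : ∀ i, g i ≤ b) (t : ℝ) (ht : 0 ≤ t) :
    (sampleMeasure p n).real {x | t ≤ (∑' k, g k * ((p k).toReal * (1 - (p k).toReal)))
        - (1 / (n * (n - 1) : ℝ)) * ∑ i, ∑ j, Ker g (x i) (x j)}
      ≤ exp (- (2 * (n / 2 : ℕ) * t ^ 2 / b ^ 2)) := by
  classical
  set κ := ∑' k, g k * ((p k).toReal * (1 - (p k).toReal)) with hκ
  set N := n / 2 with hN
  have hNpos : 0 < N := by omega
  let a0 : Fin N → Fin n := fun l => ⟨2 * l, by have := l.2; omega⟩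
  let b0 : Fin N → Fin n := fun l => ⟨2 * l + 1, by have := l.2; omega⟩
  have hab0 : ∀ l l', a0 l ≠ b0 l' := by
    intro l l' h; have := congrArg Fin.val h; simp [a0, b0] at this; omega
  have hs := subG_pair p n g b hg hgb
  have hm : ∀ σ : Equiv.Perm (Fin n), HasSubgaussianMGF
      (fun x : Fin n → ℕ => ∑ l : Fin N, (κ - Ker g (x (σ (a0 l))) (x (σ (b0 l)))))
      (N * (b / 2) ^ 2) (sampleMeasure p n) := by
    intro σ
    have := subG_match p n N (fun u v => κ - Ker g u v) ((b/2)^2) (fun l => σ (a0 l))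
      (fun l => σ (b0 l))
      (fun l l' h => by
        have := congrArg Fin.val (σ.injective h); simp [a0] at this; exact Fin.ext this)
      (fun l l' h => by
        have := congrArg Fin.val (σ.injective h); simp [b0] at this; exact Fin.ext this)
      (fun l l' h => hab0 l l' (σ.injective h)) hs Finset.univ
    simpa using this
  have hsum := subG_sum _ _ _ hm Finset.univ
  have hfac : (0:ℝ) < n.factorial := by exact_mod_cast Nat.factorial_pos n
  have hn' : (2:ℝ) ≤ n := by exact_mod_cast hn
  have hN' : (0:ℝ) < N := by exact_mod_cast hNpos
  have hbr : (0:ℝ) < b := by exact_mod_cast hb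
  have hid : ∀ x : Fin n → ℕ, ∑ σ : Equiv.Perm (Fin n),
      ∑ l : Fin N, (κ - Ker g (x (σ (a0 l))) (x (σ (b0 l))))
      = n.factorial * N * (κ - (1 / (n * (n - 1) : ℝ)) * ∑ i, ∑ j, Ker g (x i) (x j)) := by
    intro x
    rw [Finset.sum_comm]
    have : ∀ l : Fin N, ∑ σ : Equiv.Perm (Fin n), (κ - Ker g (x (σ (a0 l))) (x (σ (b0 l))))
       = n.factorial * (κ - (1 / (n * (n - 1) : ℝ)) * ∑ i, ∑ j, Ker g (x i) (x j)) := by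
      intro l
      have hp := perm_sum n (fun i j => Ker g (x i) (x j)) (by intro i; simp [Ker]) (a0 l) (b0 l)
        (hab0 _ _)
      rw [Finset.sum_sub_distrib]
      have h1 : (0:ℝ) < n * (n - 1) := by nlinarith
      have : ∑ σ : Equiv.Perm (Fin n), Ker g (x (σ (a0 l))) (x (σ (b0 l)))
        = (1 / (n * (n - 1) : ℝ)) * (n.factorial * ∑ i, ∑ j, Ker g (x i) (x j)) := by
        rw [← hp, ← mul_assoc, one_div, inv_mul_cancel₀ h1.ne', one_mul]
      rw [this]
      simp [Fintype.card_perm]; ring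
    rw [Finset.sum_congr rfl fun l _ => this l]
    simp; ring
  have hfin := hsum.measure_ge_le (ε := n.factorial * N * t) (by positivity)
  simp only [hid] at hfin
  have hset : {x : Fin n → ℕ | (n.factorial:ℝ) * N * t ≤ n.factorial * N *
      (κ - (1 / (n * (n - 1) : ℝ)) * ∑ i, ∑ j, Ker g (x i) (x j))}
      = {x | t ≤ κ - (1 / (n * (n - 1) : ℝ)) * ∑ i, ∑ j, Ker g (x i) (x j)} := by
    ext x
    simp only [Set.mem_ofPred_eq]
    rw [mul_le_mul_iff_right₀ (by positivity)]
  rw [hset] at hfin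
  refine hfin.trans (le_of_eq ?_)
  congr 1
  push_cast
  simp only [Finset.card_univ, Fintype.card_perm, Fintype.card_fin]
  field_simp

lemma pow_tangent (x y : ℝ) (hx : 0 ≤ x) (hy : 0 ≤ y) (k : ℕ) :
    x ^ (k + 1) + (k + 1) * x ^ k * (y - x) ≤ y ^ (k + 1) := by
  induction k with
  | zero => simp
  | succ k ih =>
    have h1 := mul_le_mul_of_nonneg_left ih hy
    have h2 : 0 ≤ (k + 1) * x ^ k * (y - x) ^ 2 := by positivity
    push_cast
    calc x ^ (k + 1 + 1) + (k + 1 + 1) * x ^ (k + 1) * (y - x)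
        ≤ y * (x ^ (k + 1) + (k + 1) * x ^ k * (y - x)) := by
          have : y * (x ^ (k + 1) + (k + 1) * x ^ k * (y - x)) -
            (x ^ (k + 1 + 1) + (k + 1 + 1) * x ^ (k + 1) * (y - x))
            = (k + 1) * x ^ k * (y - x) ^ 2 := by ring
          linarith
      _ ≤ _ := h1.trans_eq (by ring)

lemma fact_bound (M : ℕ) (hM : 2 ≤ M) :
    2 * ((2 * M).factorial : ℝ) ≤ 2 ^ M * (M : ℝ) ^ (2 * M) := by
  induction M, hM using Nat.le_induction with
  | base => norm_num [Nat.factorial]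
  | succ M hM ih =>
    have hMr : (2:ℝ) ≤ M := by exact_mod_cast hM
    have h1 : 2 * (M:ℝ) ^ M ≤ ((M:ℝ) + 1) ^ M := by
      obtain ⟨k, rfl⟩ : ∃ k, M = k + 1 := ⟨M - 1, by omega⟩
      have := pow_tangent ((k + 1 : ℕ) : ℝ) ((k + 1 : ℕ) + 1) (by positivity) (by positivity) k
      push_cast at this ⊢
      refine le_trans (le_of_eq ?_) this
      ring
    have h2 : 4 * (M:ℝ) ^ (2 * M) ≤ ((M:ℝ) + 1) ^ (2 * M) := by
      have := mul_le_mul h1 h1 (by positivity) (by positivity)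
      calc 4 * (M:ℝ) ^ (2 * M) = 2 * (M:ℝ) ^ M * (2 * (M:ℝ) ^ M) := by ring
        _ ≤ _ := this
        _ = _ := by ring
    have e : 2 * (M + 1) = (2 * M + 1) + 1 := by ring
    rw [e, Nat.factorial_succ, Nat.factorial_succ]
    push_cast
    calc 2 * ((2 * (M:ℝ) + 1 + 1) * ((2 * M + 1) * (2 * M).factorial))
        = (2 * ((2 * M).factorial : ℝ)) * ((2 * M + 2) * (2 * M + 1)) := by ring
      _ ≤ (2 ^ M * (M : ℝ) ^ (2 * M)) * ((2 * M + 2) * (2 * M + 1)) := by gcongr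
      _ ≤ (2 ^ M * (M : ℝ) ^ (2 * M)) * (8 * (M + 1) ^ 2) :=
          mul_le_mul_of_nonneg_left (by nlinarith) (by positivity)
      _ = 2 ^ (M + 1) * (4 * (M : ℝ) ^ (2 * M)) * (M + 1) ^ 2 := by ring
      _ ≤ 2 ^ (M + 1) * (((M:ℝ) + 1) ^ (2 * M)) * (M + 1) ^ 2 := by gcongr
      _ = _ := by ring

lemma cosh_lower (M : ℕ) (hM : 1 ≤ M) (x : ℝ) :
    x ^ (2 * M) / (2 * M).factorial ≤ Real.cosh x - 1 := by
  have h := sum_le_hasSum {0, M} (fun i _ => by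
    rw [pow_mul]; positivity) (Real.hasSum_cosh x)
  rw [Finset.sum_pair (by omega)] at h
  simp at h
  linarith

noncomputable def Y (p : PMF ℕ) (n : ℕ) (i : ℕ) (x : Fin n → ℕ) : ℝ :=
  ∑ j, ((if x j = i then 1 else 0) - (p i).toReal)

lemma Y_bdd (p : PMF ℕ) (n : ℕ) (i : ℕ) (x : Fin n → ℕ) : |Y p n i x| ≤ n := by
  unfold Y
  refine (Finset.abs_sum_le_sum_abs _ _).trans ?_
  have : ∀ j ∈ (Finset.univ : Finset (Fin n)),
      |(if x j = i then (1:ℝ) else 0) - (p i).toReal| ≤ 1 := by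
    intro j _
    have h1 := pmf_le_one p i
    have h0 : 0 ≤ (p i).toReal := ENNReal.toReal_nonneg
    rw [abs_le]; split_ifs <;> constructor <;> linarith
  simpa using Finset.sum_le_sum this

lemma mgf_Y (p : PMF ℕ) (n : ℕ) (i : ℕ) (s : ℝ) (hs : |s| ≤ 1) :
    ∫ x, exp (s * Y p n i x) ∂(sampleMeasure p n)
      ≤ exp ((n * ((p i).toReal * (1 - (p i).toReal))) * s ^ 2) := by
  set q := (p i).toReal with hq
  have h1 : q ≤ 1 := pmf_le_one p i
  have h0 : 0 ≤ q := ENNReal.toReal_nonneg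
  have e1 : ∀ x : Fin n → ℕ, exp (s * Y p n i x)
      = ∏ j, exp (s * ((if x j = i then 1 else 0) - q)) := by
    intro x; rw [← Real.exp_sum, Y, Finset.mul_sum]
  simp only [e1]
  unfold sampleMeasure
  rw [integral_fintype_prod_eq_pow (fun a : ℕ => exp (s * ((if a = i then 1 else 0) - q)))]
  have e2 : ∫ a, exp (s * ((if a = i then 1 else 0) - q)) ∂p.toMeasure
      = q * exp (s * (1 - q)) + (1 - q) * exp (- s * q) := by
    have : (fun a : ℕ => exp (s * ((if a = i then 1 else 0) - q)))
        = fun a => exp (- s * q) +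
          Set.indicator {i} (fun _ => exp (s * (1 - q)) - exp (- s * q)) a := by
      funext a
      by_cases h : a = i
      · subst h; simp
      · simp [h]
    rw [this, integral_add (integrable_const _) ((integrable_const _).indicator .of_discrete),
      integral_indicator_const _ (.of_discrete), pmf_real]
    simp [← hq]; ring
  rw [e2]
  have hb : ∀ u : ℝ, |u| ≤ 1 → exp u ≤ 1 + u + u ^ 2 := by
    intro u hu
    have := (abs_le.1 (Real.abs_exp_sub_one_sub_id_le hu)).2
    linarith
  have b1 := hb (s * (1 - q)) (by
    rw [abs_mul, abs_of_nonneg (by linarith : 0 ≤ 1 - q)]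
    exact mul_le_one₀ hs (by linarith) (by linarith))
  have b2 := hb (- s * q) (by
    rw [abs_mul, abs_of_nonneg h0, abs_neg]
    exact mul_le_one₀ hs (by linarith) (by linarith))
  have b3 : q * exp (s * (1 - q)) + (1 - q) * exp (- s * q) ≤ exp ((q * (1 - q)) * s ^ 2) := by
    calc q * exp (s * (1 - q)) + (1 - q) * exp (- s * q)
        ≤ q * (1 + s * (1 - q) + (s * (1 - q)) ^ 2) + (1 - q) * (1 + - s * q + (- s * q) ^ 2) := by
          gcongr
      _ = (q * (1 - q)) * s ^ 2 + 1 := by ring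
      _ ≤ _ := Real.add_one_le_exp _
  calc _ ≤ exp ((q * (1 - q)) * s ^ 2) ^ Fintype.card (Fin n) := by
        gcongr
    _ = _ := by rw [← Real.exp_nat_mul]; simp; ring_nf

lemma tailA (p : PMF ℕ) (n : ℕ) (i : ℕ) (M : ℕ) (hM : 1 ≤ M) (r s : ℝ) (hr : 0 < r)
    (hs : 0 < s) (hs1 : s ≤ 1) :
    (sampleMeasure p n).real {x | r ≤ |Y p n i x|} * r ^ (2 * M) ≤
      (exp ((n * ((p i).toReal * (1 - (p i).toReal))) * s ^ 2) - 1) * (2 * M).factorial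
        / s ^ (2 * M) := by
  set lam := n * ((p i).toReal * (1 - (p i).toReal))
  have hint : ∀ u : ℝ, |u| ≤ 1 → Integrable (fun x => exp (u * Y p n i x)) (sampleMeasure p n) := by
    intro u hu
    refine integrable_bdd _ _ (exp n) fun x => ?_
    rw [abs_of_nonneg (exp_nonneg _)]
    refine exp_le_exp.2 ((le_abs_self _).trans ?_)
    rw [abs_mul]
    calc |u| * |Y p n i x| ≤ 1 * n := mul_le_mul hu (Y_bdd _ _ _ _) (abs_nonneg _) zero_le_one
      _ = n := one_mul _
  have hsa : |s| ≤ 1 := by rwa [abs_of_pos hs]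
  have hsa' : |-s| ≤ 1 := by rwa [abs_neg]
  have hcosh : ∀ x, Real.cosh (s * Y p n i x) - 1
      = (exp (s * Y p n i x) + exp (-s * Y p n i x)) / 2 - 1 := by
    intro x; rw [Real.cosh_eq]; simp
  have hI : Integrable (fun x => Real.cosh (s * Y p n i x) - 1) (sampleMeasure p n) := by
    simp only [hcosh]
    exact (((hint s hsa).add (hint (-s) hsa')).div_const 2).sub (integrable_const _)
  have hInt : ∫ x, (Real.cosh (s * Y p n i x) - 1) ∂(sampleMeasure p n) ≤ exp (lam * s ^ 2) - 1 := by
    simp only [hcosh]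
    have hadd : Integrable (fun x => (exp (s * Y p n i x) + exp (-s * Y p n i x)) / 2)
        (sampleMeasure p n) := ((hint s hsa).add (hint (-s) hsa')).div_const 2
    rw [integral_sub hadd (integrable_const _), integral_div, integral_add (hint s hsa) (hint (-s) hsa')]
    have h1 := mgf_Y p n i s hsa
    have h2 := mgf_Y p n i (-s) hsa'
    rw [neg_sq] at h2
    simp only [integral_const, probReal_univ, smul_eq_mul, mul_one]
    change _ ≤ exp (lam * s ^ 2) at h1
    change _ ≤ exp (lam * s ^ 2) at h2
    linarith
  have hmk := mul_meas_ge_le_integral_of_nonneg (μ := sampleMeasure p n)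
    (f := fun x => Real.cosh (s * Y p n i x) - 1)
    (Eventually.of_forall fun x => by simp) hI
    ((s * r) ^ (2 * M) / (2 * M).factorial)
  have hmono : (sampleMeasure p n).real {x | r ≤ |Y p n i x|} ≤
      (sampleMeasure p n).real {x | (s * r) ^ (2 * M) / (2 * M).factorial ≤
        Real.cosh (s * Y p n i x) - 1} := by
    refine measureReal_mono ?_ (measure_ne_top _ _)
    intro x hx
    simp only [Set.mem_ofPred_eq] at hx ⊢
    refine le_trans ?_ (cosh_lower M hM _)
    have : (s * r) ^ (2 * M) ≤ (s * Y p n i x) ^ (2 * M) := by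
      have e : (s * Y p n i x) ^ (2 * M) = (s * |Y p n i x|) ^ (2 * M) := by
        rw [mul_pow, mul_pow, (even_two_mul M).pow_abs]
      rw [e]; gcongr
    gcongr
  rw [le_div_iff₀ (by positivity)]
  have hf : (0:ℝ) < (2 * M).factorial := by exact_mod_cast Nat.factorial_pos _
  have h3 : (s * r) ^ (2 * M) / (2 * M).factorial *
      (sampleMeasure p n).real {x | r ≤ |Y p n i x|} ≤ exp (lam * s ^ 2) - 1 :=
    (mul_le_mul_of_nonneg_left hmono (by positivity)).trans (hmk.trans hInt)
  have h4 := mul_le_mul_of_nonneg_right h3 hf.le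
  refine le_trans (le_of_eq ?_) h4
  rw [mul_pow]; field_simp

noncomputable def ff (M : ℕ) (x : ℝ) : ℝ := ∑ k ∈ Finset.Icc 1 M, x ^ k

lemma exp_sub_one_le (u : ℝ) (h0 : 0 ≤ u) (h1 : u ≤ 1) : exp u - 1 ≤ u + u ^ 2 := by
  have := (abs_le.1 (Real.abs_exp_sub_one_sub_id_le (x := u) (by rwa [abs_of_nonneg h0]))).2
  linarith

lemma tailB (p : PMF ℕ) (n : ℕ) (i : ℕ) (M : ℕ) (hM : 1 ≤ M) (r : ℝ) (hr : 0 < r) :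
    (sampleMeasure p n).real {x | r ≤ |Y p n i x|} * r ^ (2 * M) ≤
      2 ^ M * (M : ℝ) ^ (2 * M) * ff M (n * ((p i).toReal * (1 - (p i).toReal))) := by
  have A := tailA p n i M hM r
  set lam := n * ((p i).toReal * (1 - (p i).toReal)) with hlam
  have hl0 : 0 ≤ lam := by
    have := pmf_le_one p i
    have h0 : 0 ≤ (p i).toReal := ENNReal.toReal_nonneg
    have : 0 ≤ 1 - (p i).toReal := by linarith
    positivity
  set P := (sampleMeasure p n).real {x | r ≤ |Y p n i x|}
  rcases hM.eq_or_lt with rfl | hM2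
  · simp only [ff, Finset.Icc_self, Finset.sum_singleton]
    norm_num at A ⊢
    refine le_of_forall_pos_le_add fun ε hε => ?_
    have hq : 0 < min 1 (min (1 / (lam + 1)) (ε / (2 * lam ^ 2 + 1))) := by positivity
    set w := min 1 (min (1 / (lam + 1)) (ε / (2 * lam ^ 2 + 1))) with hw
    have hw1 : w ≤ 1 := min_le_left _ _
    have hw2 : w ≤ 1 / (lam + 1) := (min_le_right _ _).trans (min_le_left _ _)
    have hw3 : w ≤ ε / (2 * lam ^ 2 + 1) := (min_le_right _ _).trans (min_le_right _ _)
    rw [le_div_iff₀ (by positivity)] at hw2 hw3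
    have := A (√w) hr (Real.sqrt_pos.2 hq) (Real.sqrt_le_one.2 hw1)
    rw [Real.sq_sqrt hq.le] at this
    have hx := exp_sub_one_le (lam * w) (by positivity) (by nlinarith)
    calc _ ≤ _ := this
      _ ≤ (lam * w + (lam * w) ^ 2) * 2 / w := by gcongr
      _ = 2 * lam + 2 * lam ^ 2 * w := by field_simp
      _ ≤ _ := by nlinarith
  · have hfb := fact_bound M hM2
    have hterm : ∀ k ∈ Finset.Icc 1 M, lam ^ k ≤ ff M lam := fun k hk =>
      Finset.single_le_sum (f := fun k => lam ^ k) (fun k _ => by positivity) hk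
    have hle : ∀ z, 0 ≤ z → z ≤ ff M lam → 2 * z * (2 * M).factorial ≤
        2 ^ M * (M : ℝ) ^ (2 * M) * ff M lam := by
      intro z hz hz2
      calc 2 * z * (2 * M).factorial = 2 * (2 * M).factorial * z := by ring
        _ ≤ _ := mul_le_mul hfb hz2 hz (by positivity)
    rcases le_total lam 1 with h | h
    · refine (A 1 hr one_pos le_rfl).trans ?_
      have hx := exp_sub_one_le lam hl0 h
      have h1 := hterm 1 (by simp; omega)
      rw [pow_one] at h1
      refine le_trans ?_ (hle lam hl0 h1)
      simp only [one_pow, mul_one, div_one]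
      gcongr
      nlinarith
    · have hlp : 0 < lam := by linarith
      refine (A (1 / √lam) hr (by positivity) (by
        rw [div_le_one (by positivity)]; exact Real.one_le_sqrt.2 h)).trans ?_
      have h1 := hterm M (by simp; omega)
      refine le_trans ?_ (hle (lam ^ M) (by positivity) h1)
      have e1 : (1 / √lam) ^ 2 = 1 / lam := by rw [div_pow, Real.sq_sqrt hl0, one_pow]
      rw [pow_mul, e1, mul_one_div_cancel hlp.ne', one_div, inv_pow, div_inv_eq_mul]
      have hx := exp_sub_one_le 1 zero_le_one le_rfl
      calc (exp 1 - 1) * (2 * M).factorial * lam ^ M ≤ 2 * (2 * M).factorial * lam ^ M := by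
            gcongr; linarith
        _ = _ := by ring

lemma mle_nonneg (n : ℕ) (x : Fin n → ℕ) (i : ℕ) : 0 ≤ mle n x i := by unfold mle; positivity

lemma mle_le_one (n : ℕ) (x : Fin n → ℕ) (i : ℕ) : mle n x i ≤ 1 := by
  unfold mle
  apply div_le_one_of_le₀ _ (by positivity)
  have := Finset.card_filter_le (Finset.univ : Finset (Fin n)) (fun j => x j = i)
  simp only [Finset.card_univ, Fintype.card_fin] at this
  exact_mod_cast this

lemma Y_eq (p : PMF ℕ) (n : ℕ) (hn : 0 < n) (i : ℕ) (x : Fin n → ℕ) :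
    Y p n i x = n * (mle n x i - (p i).toReal) := by
  have : (n:ℝ) ≠ 0 := by positivity
  unfold Y mle
  rw [Finset.sum_sub_distrib]
  simp
  field_simp

lemma mle_zero (n : ℕ) (x : Fin n → ℕ) (i : ℕ) (h : i ∉ Finset.univ.image x) : mle n x i = 0 := by
  unfold mle
  have : (Finset.univ.filter fun j => x j = i) = ∅ := by
    rw [Finset.filter_eq_empty_iff]
    intro j _ hj
    exact h (Finset.mem_image.2 ⟨j, Finset.mem_univ _, hj⟩)
  simp [this]

noncomputable def vh (n : ℕ) (x : Fin n → ℕ) (i : ℕ) : ℝ := mle n x i * (1 - mle n x i)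

lemma vh_nonneg (n : ℕ) (x : Fin n → ℕ) (i : ℕ) : 0 ≤ vh n x i :=
  mul_nonneg (mle_nonneg _ _ _) (by linarith [mle_le_one n x i])

lemma vh_zero (n : ℕ) (x : Fin n → ℕ) (i : ℕ) (h : i ∉ Finset.univ.image x) : vh n x i = 0 := by
  simp [vh, mle_zero n x i h]

lemma sum_Ker (n : ℕ) (hn : 0 < n) (g : ℕ → ℝ) (x : Fin n → ℕ) :
    ∑ i, ∑ j, Ker g (x i) (x j) = n ^ 2 * ∑' k, g k * vh n x k := by
  have hn' : (n:ℝ) ≠ 0 := by positivity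
  rw [tsum_eq_sum (s := Finset.univ.image x) (fun k hk => by simp [vh_zero n x k hk])]
  have h1 : ∀ i, ∑ j, Ker g (x i) (x j) = (fun k => g k * (n * (1 - mle n x k))) (x i) := by
    intro i
    have : ∀ j, Ker g (x i) (x j) = g (x i) - g (x i) * (if x j = x i then 1 else 0) := by
      intro j; unfold Ker
      by_cases h : x i = x j
      · simp [h]
      · simp [h, Ne.symm h]
    simp only [this]
    rw [Finset.sum_sub_distrib, ← Finset.mul_sum]
    simp [mle]
    field_simp
  simp only [h1]
  rw [Finset.sum_comp (fun k => g k * (n * (1 - mle n x k))) x, Finset.mul_sum]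
  refine Finset.sum_congr rfl fun k _ => ?_
  have : ((Finset.univ.filter fun j => x j = k).card : ℝ) = n * mle n x k := by
    unfold mle; field_simp
  rw [nsmul_eq_mul, this]
  unfold vh; ring

noncomputable def gg (n M : ℕ) (v : ℝ) : ℝ := ∑ k ∈ Finset.Icc 1 M, k * (n : ℝ) ^ k * v ^ (k - 1)

lemma gg_nonneg (n M : ℕ) (v : ℝ) (hv : 0 ≤ v) : 0 ≤ gg n M v :=
  Finset.sum_nonneg fun k _ => by positivity

lemma gg_le (n M : ℕ) (hn : 1 ≤ n) (v : ℝ) (hv : 0 ≤ v) (hv1 : v ≤ 1) :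
    gg n M v ≤ M ^ 2 * (n:ℝ) ^ M := by
  have : ∀ k ∈ Finset.Icc 1 M, k * (n : ℝ) ^ k * v ^ (k - 1) ≤ M * (n:ℝ) ^ M := by
    intro k hk
    rw [Finset.mem_Icc] at hk
    have h1 : (k:ℝ) ≤ M := by exact_mod_cast hk.2
    have h2 : (n:ℝ) ^ k ≤ (n:ℝ) ^ M := pow_le_pow_right₀ (by exact_mod_cast hn) hk.2
    have h3 : v ^ (k - 1) ≤ 1 := pow_le_one₀ hv hv1
    calc k * (n : ℝ) ^ k * v ^ (k - 1) ≤ M * (n:ℝ) ^ M * 1 := by gcongr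
      _ = _ := mul_one _
  refine (Finset.sum_le_sum this).trans (le_of_eq ?_)
  simp; ring

lemma ff_tangent (n M : ℕ) (v w : ℝ) (hv : 0 ≤ v) (hw : 0 ≤ w) :
    ff M (n * v) + gg n M v * (2 * w - v) ≤ 2 ^ M * ff M (n * w) := by
  unfold ff gg
  rw [Finset.sum_mul, Finset.mul_sum, ← Finset.sum_add_distrib]
  refine Finset.sum_le_sum fun k hk => ?_
  rw [Finset.mem_Icc] at hk
  obtain ⟨j, rfl⟩ : ∃ j, k = j + 1 := ⟨k - 1, by omega⟩
  have h := pow_tangent (n * v) (n * (2 * w)) (by positivity) (by positivity) j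
  have h2 : (2:ℝ) ^ (j + 1) ≤ 2 ^ M := pow_le_pow_right₀ (by norm_num) hk.2
  calc _ = (n * v) ^ (j + 1) + (j + 1) * (n * v) ^ j * (n * (2 * w) - n * v) := by
        push_cast; simp only [mul_pow]; ring
    _ ≤ _ := h
    _ = 2 ^ (j + 1) * (n * w) ^ (j + 1) := by simp only [mul_pow]; ring
    _ ≤ _ := by gcongr

noncomputable def vv (p : PMF ℕ) (i : ℕ) : ℝ := (p i).toReal * (1 - (p i).toReal)

lemma vv_nonneg (p : PMF ℕ) (i : ℕ) : 0 ≤ vv p i :=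
  mul_nonneg ENNReal.toReal_nonneg (by linarith [pmf_le_one p i])

lemma vv_le (p : PMF ℕ) (i : ℕ) : vv p i ≤ (p i).toReal := by
  have h0 : 0 ≤ (p i).toReal := ENNReal.toReal_nonneg
  unfold vv; nlinarith

lemma vv_le_one (p : PMF ℕ) (i : ℕ) : vv p i ≤ 1 := (vv_le p i).trans (pmf_le_one p i)

lemma summable_vv (p : PMF ℕ) : Summable (vv p) := by
  refine Summable.of_nonneg_of_le (vv_nonneg p) (vv_le p) ?_
  exact ENNReal.summable_toReal (by rw [p.tsum_coe]; simp)

lemma summable_ff (p : PMF ℕ) (n M : ℕ) : Summable (fun i => ff M (n * vv p i)) := by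
  unfold ff
  refine summable_sum fun k hk => ?_
  rw [Finset.mem_Icc] at hk
  refine Summable.of_nonneg_of_le (fun i => by have := vv_nonneg p i; positivity) (fun i => ?_)
    ((summable_vv p).mul_left ((n:ℝ) ^ k))
  rw [mul_pow]
  have h0 := vv_nonneg p i
  gcongr
  exact pow_le_of_le_one h0 (vv_le_one p i) (by omega)

lemma emp (p : PMF ℕ) (n M : ℕ) (hn : 1 ≤ n) (x : Fin n → ℕ) (t : ℝ)
    (h : (∑' k, gg n M (vv p k) * vv p k) - 2 * ∑' k, gg n M (vv p k) * vh n x k ≤ t) :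
    ∑' i, ff M (n * vv p i) ≤ 2 ^ M * (∑' i, ff M (n * vh n x i)) + t := by
  have s1 := summable_ff p n M
  have s2 : Summable (fun k => gg n M (vv p k) * vv p k) := by
    refine Summable.of_nonneg_of_le (fun i => mul_nonneg (gg_nonneg _ _ _ (vv_nonneg p i))
      (vv_nonneg p i)) (fun i => ?_) ((summable_vv p).mul_left (M ^ 2 * (n:ℝ) ^ M))
    exact mul_le_mul_of_nonneg_right (gg_le n M hn _ (vv_nonneg p i) (vv_le_one p i))
      (vv_nonneg p i)
  have s3 : Summable (fun k => gg n M (vv p k) * vh n x k) :=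
    summable_of_ne_finset_zero (s := Finset.univ.image x) (fun k hk => by simp [vh_zero n x k hk])
  have hff0 : ff M 0 = 0 := by
    unfold ff
    refine Finset.sum_eq_zero fun k hk => ?_
    rw [Finset.mem_Icc] at hk
    exact zero_pow (by omega)
  have s4 : Summable (fun k => ff M (n * vh n x k)) :=
    summable_of_ne_finset_zero (s := Finset.univ.image x)
      (fun k hk => by simp [vh_zero n x k hk, hff0])
  have key := Summable.tsum_le_tsum (fun i => ff_tangent n M (vv p i) (vh n x i) (vv_nonneg p i)
    (vh_nonneg n x i)) (s1.add (((s3.mul_left 2).sub s2).congr (fun k => by ring)))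
    (s4.mul_left (2 ^ M))
  have e : ∑' i, (ff M (n * vv p i) + gg n M (vv p i) * (2 * vh n x i - vv p i))
      = ∑' i, ff M (n * vv p i) + (2 * (∑' k, gg n M (vv p k) * vh n x k)
        - ∑' k, gg n M (vv p k) * vv p k) := by
    rw [← tsum_mul_left, ← (s3.mul_left 2).tsum_sub s2,
      ← s1.tsum_add ((s3.mul_left 2).sub s2)]
    exact tsum_congr fun k => by ring
  rw [e, tsum_mul_left] at key
  linarith

/-- the second good event -/
lemma good2 (p : PMF ℕ) (n M : ℕ) (hn : 2 ≤ n) (hM : 1 ≤ M) (t : ℝ) (ht : 0 ≤ t) :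
    (sampleMeasure p n).real {x | ¬ ∑' i, ff M (n * vv p i) ≤
        2 ^ M * (∑' i, ff M (n * vh n x i)) + t}
      ≤ exp (- (2 * (n / 2 : ℕ) * t ^ 2 / (M ^ 2 * (n:ℝ) ^ M) ^ 2)) := by
  have hn' : (2:ℝ) ≤ n := by exact_mod_cast hn
  have hMp : (0:NNReal) < M := by exact_mod_cast hM
  have hnp : (0:NNReal) < n := by exact_mod_cast (by omega : 0 < n)
  have hu := ustat p n hn (fun k => gg n M (vv p k)) (M ^ 2 * (n:NNReal) ^ M) (by positivity)
    (fun i => gg_nonneg _ _ _ (vv_nonneg p i)) (fun i => by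
      push_cast
      exact gg_le n M (by omega) _ (vv_nonneg p i) (vv_le_one p i)) t ht
  push_cast at hu
  refine le_trans (measureReal_mono ?_ (measure_ne_top _ _)) hu
  intro x hx
  simp only [Set.mem_ofPred_eq] at hx ⊢
  by_contra hcon
  push Not at hcon
  apply hx
  apply emp p n M (by omega) x t
  rw [sum_Ker n (by omega)] at hcon
  change (∑' k, gg n M (vv p k) * vv p k) - _ < t at hcon
  refine le_trans ?_ hcon.le
  have h0 : 0 ≤ ∑' k, gg n M (vv p k) * vh n x k := tsum_nonneg fun k =>
    mul_nonneg (gg_nonneg _ _ _ (vv_nonneg p k)) (vh_nonneg n x k)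
  have h1 : (1 / (n * (n - 1) : ℝ)) * n ^ 2 ≤ 2 := by
    rw [one_div, inv_mul_le_iff₀ (by nlinarith)]; nlinarith
  have := mul_le_mul_of_nonneg_right h1 h0
  rw [mul_assoc] at this
  linarith

/-- the first good event -/
lemma good1 (p : PMF ℕ) (n M : ℕ) (hM : 1 ≤ M) (δ : ℝ) (hδ : 0 < δ) :
    sampleMeasure p n {x | ¬ ∀ i, |Y p n i x| ^ (2 * M) ≤
        2 ^ M * (M : ℝ) ^ (2 * M) / δ * ∑' i, ff M (n * vv p i)} ≤ ENNReal.ofReal δ := by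
  set C := 2 ^ M * (M : ℝ) ^ (2 * M) with hC
  set S := ∑' i, ff M (n * vv p i) with hS
  have hMr : (1:ℝ) ≤ M := by exact_mod_cast hM
  have hCp : 0 < C := by positivity
  have hff : ∀ i, 0 ≤ ff M (n * vv p i) := fun i => by
    unfold ff
    exact Finset.sum_nonneg fun k _ => by have := vv_nonneg p i; positivity
  have hS0 : 0 ≤ S := tsum_nonneg hff
  have hsub : {x | ¬ ∀ i, |Y p n i x| ^ (2 * M) ≤ C / δ * S}
      ⊆ ⋃ i, {x | C / δ * S < |Y p n i x| ^ (2 * M)} := by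
    intro x hx
    simp only [Set.mem_ofPred_eq, not_forall, not_le] at hx
    simpa using hx
  refine (measure_mono hsub).trans ((measure_iUnion_le _).trans ?_)
  have tB : ∀ i r, 0 < r → (sampleMeasure p n).real {x | r ≤ |Y p n i x|} * r ^ (2 * M) ≤
      C * ff M (n * vv p i) := fun i r hr => tailB p n i M hM r hr
  rcases hS0.eq_or_lt with h0 | hpos
  · have hz : ∀ i, ff M (n * vv p i) = 0 := fun i => by
      have := (summable_ff p n M).le_tsum i (fun j _ => hff j)
      exact le_antisymm (by rw [← hS, ← h0] at this; exact this) (hff i)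
    have : ∀ i, sampleMeasure p n {x | C / δ * S < |Y p n i x| ^ (2 * M)} = 0 := by
      intro i
      have hs2 : {x | C / δ * S < |Y p n i x| ^ (2 * M)} ⊆
          ⋃ k : ℕ, {x | 1 / ((k:ℝ) + 1) ≤ |Y p n i x|} := by
        intro x hx
        simp only [Set.mem_ofPred_eq, ← h0, mul_zero] at hx
        have : 0 < |Y p n i x| := by
          rcases (abs_nonneg (Y p n i x)).eq_or_lt with h | h
          · rw [← h, zero_pow (by omega)] at hx; exact absurd hx (lt_irrefl _)
          · exact h
        obtain ⟨k, hk⟩ := exists_nat_one_div_lt this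
        exact Set.mem_iUnion.2 ⟨k, hk.le⟩
      refine measure_mono_null hs2 (measure_iUnion_null fun k => ?_)
      have := tB i (1 / ((k:ℝ) + 1)) (by positivity)
      rw [hz, mul_zero] at this
      have hr : (0:ℝ) < (1 / ((k:ℝ) + 1)) ^ (2 * M) := by positivity
      have h3 : (sampleMeasure p n).real {x | 1 / ((k:ℝ) + 1) ≤ |Y p n i x|} = 0 :=
        le_antisymm (by by_contra hc; push Not at hc; nlinarith [mul_pos hc hr]) measureReal_nonneg
      exact (measureReal_eq_zero_iff (measure_ne_top _ _)).1 h3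
    simp [this]
  · set A := C / δ * S with hA
    have hAp : 0 < A := by positivity
    set r := A ^ ((1:ℝ) / (2 * M : ℕ)) with hr
    have hrp : 0 < r := by positivity
    have hrA : r ^ (2 * M) = A := by
      rw [hr, one_div]
      exact Real.rpow_inv_natCast_pow hAp.le (by omega)
    have hi : ∀ i, sampleMeasure p n {x | A < |Y p n i x| ^ (2 * M)} ≤
        ENNReal.ofReal (δ / S * ff M (n * vv p i)) := by
      intro i
      have h1 : {x | A < |Y p n i x| ^ (2 * M)} ⊆ {x | r ≤ |Y p n i x|} := by
        intro x hx
        simp only [Set.mem_ofPred_eq] at hx ⊢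
        rw [← hrA] at hx
        exact (lt_of_pow_lt_pow_left₀ _ (abs_nonneg _) hx).le
      refine (measure_mono h1).trans ?_
      rw [← ENNReal.ofReal_toReal (measure_ne_top (sampleMeasure p n) {x | r ≤ |Y p n i x|})]
      apply ENNReal.ofReal_le_ofReal
      have := tB i r hrp
      rw [hrA, ← le_div_iff₀ hAp] at this
      refine this.trans (le_of_eq ?_)
      rw [hA]; field_simp
    refine (ENNReal.tsum_le_tsum hi).trans (le_of_eq ?_)
    rw [← ENNReal.ofReal_tsum_of_nonneg (fun i => mul_nonneg (by positivity) (hff i))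
      ((summable_ff p n M).mul_left _), tsum_mul_left, ← hS, div_mul_cancel₀ _ hpos.ne']

lemma four_bound (M : ℕ) (hM : 1 ≤ M) : 4 * (M:ℝ) ^ 2 ≤ 4 ^ M := by
  obtain ⟨k, rfl⟩ : ∃ k, M = k + 1 := ⟨M - 1, by omega⟩
  have h1 : ((k + 1 : ℕ):ℝ) ≤ 2 ^ k := by exact_mod_cast (Nat.lt_two_pow_self (n := k))
  have h2 := mul_le_mul h1 h1 (by positivity) (by positivity)
  have h3 : (4:ℝ) ^ (k + 1) = 4 * (2 ^ k * 2 ^ k) := by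
    rw [← mul_pow]; norm_num; ring
  rw [h3]; nlinarith

lemma final_real (n M : ℕ) (hn : 2 ≤ n) (hM : 1 ≤ M) (δ L t S Sh y : ℝ) (hδ : 0 < δ) (hL : 0 < L)
    (ht : t = M ^ 2 * (n:ℝ) ^ M * √(L / (2 * (n / 2 : ℕ)))) (hSh : 0 ≤ Sh)
    (hS : S ≤ 2 ^ M * Sh + t)
    (hy : |(n:ℝ) * y| ^ (2 * M) ≤ 2 ^ M * (M : ℝ) ^ (2 * M) / δ * S) :
    |y| ≤ (((2 * M : ℕ) : ℝ) / δ ^ ((1 : ℝ) / (2 * M : ℕ))) * (1 / n) * Sh ^ ((1 : ℝ) / (2 * M : ℕ)) +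
            Real.sqrt (2 * Real.exp (1 / Real.exp 1)) *
              (((2 * M : ℕ) : ℝ) / δ ^ ((1 : ℝ) / (2 * M : ℕ))) *
              L ^ ((1 : ℝ) / (2 * (2 * M : ℕ))) *
              ((n : ℝ) ^ (-(1 / 2 : ℝ) * (1 + 1 / ((2 * M : ℕ) : ℝ))) +
                24 * (n : ℝ) ^ (-(1 / 2 : ℝ) * (1 + 5 / ((2 * M : ℕ) : ℝ)))) := by
  have hn' : (2:ℝ) ≤ n := by exact_mod_cast hn
  have hnp : (0:ℝ) < n := by linarith
  have hMr : (1:ℝ) ≤ M := by exact_mod_cast hM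
  set m := 2 * M with hm
  have hm0 : m ≠ 0 := by omega
  have hmr : (m:ℝ) ≠ 0 := by exact_mod_cast hm0
  have hmM : (m:ℝ) = 2 * M := by rw [hm]; push_cast; ring
  set a := Real.sqrt (2 * Real.exp (1 / Real.exp 1)) with ha
  set D := (m:ℝ) / δ ^ ((1 : ℝ) / m) with hD
  have hDp : 0 < D := by positivity
  set E1 := (n : ℝ) ^ (-(1 / 2 : ℝ) * (1 + 1 / (m : ℝ))) with hE1
  set E2 := (n : ℝ) ^ (-(1 / 2 : ℝ) * (1 + 5 / (m : ℝ))) with hE2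
  have hE1p : 0 < E1 := by positivity
  have hE2p : 0 < E2 := by positivity
  set Lr := L ^ ((1 : ℝ) / (2 * m)) with hLr
  have hLrp : 0 < Lr := by positivity
  have hap : 0 < a := by positivity
  set T := a * Lr * (n * E1) with hT
  have hTp : 0 < T := by positivity
  have hLm : Lr ^ m = √L := by
    rw [hLr, ← Real.rpow_natCast, ← Real.rpow_mul hL.le, Real.sqrt_eq_rpow]
    congr 1; field_simp
  have hEm : (n * E1) ^ m = (n:ℝ) ^ M / √n := by
    rw [mul_pow, hE1, ← Real.rpow_natCast (_ ^ _), ← Real.rpow_mul hnp.le, Real.sqrt_eq_rpow,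
      ← Real.rpow_natCast, ← Real.rpow_natCast, ← Real.rpow_add hnp, ← Real.rpow_sub hnp]
    congr 1
    field_simp
    rw [hmM]; ring
  have ham : (2:ℝ) ^ M ≤ a ^ m := by
    rw [hm, pow_mul, ha, Real.sq_sqrt (by positivity)]
    have : (1:ℝ) ≤ Real.exp (1 / Real.exp 1) := Real.one_le_exp (by positivity)
    gcongr; linarith
  have hTm : T ^ m = a ^ m * √L * ((n:ℝ) ^ M / √n) := by
    rw [hT, mul_pow, mul_pow, hLm, hEm]
  have htT : t ≤ 2 ^ M * T ^ m := by
    have h1 : √(L / (2 * (n / 2 : ℕ))) ≤ 4 * (√L / √n) := by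
      have hN : (n:ℝ) ≤ 4 * (n / 2 : ℕ) := by
        have : n ≤ 4 * (n / 2) := by omega
        exact_mod_cast this
      have : L / (2 * (n / 2 : ℕ)) ≤ 4 ^ 2 * (L / n) := by
        rw [div_le_iff₀ (by linarith)] 
        have : L * 1 ≤ L * (16 * (2 * (n / 2 : ℕ)) / n) := by
          apply mul_le_mul_of_nonneg_left _ hL.le
          rw [le_div_iff₀ hnp]; linarith
        calc L = L * 1 := by ring
          _ ≤ _ := this
          _ = _ := by ring
      calc _ ≤ √(4 ^ 2 * (L / n)) := Real.sqrt_le_sqrt this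
        _ = _ := by rw [Real.sqrt_mul (by positivity), Real.sqrt_sq (by norm_num),
                      Real.sqrt_div hL.le]
    rw [ht, hTm]
    calc M ^ 2 * (n:ℝ) ^ M * √(L / (2 * (n / 2 : ℕ))) ≤ M ^ 2 * (n:ℝ) ^ M * (4 * (√L / √n)) := by
          gcongr
      _ = (4 * (M:ℝ) ^ 2) * (√L * ((n:ℝ) ^ M / √n)) := by ring
      _ ≤ 4 ^ M * (√L * ((n:ℝ) ^ M / √n)) := by
          have := four_bound M hM
          gcongr
      _ = 2 ^ M * (2 ^ M * √L * ((n:ℝ) ^ M / √n)) := by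
          rw [show (4:ℝ) = 2 * 2 by norm_num, mul_pow]; ring
      _ ≤ _ := by gcongr
  set R := Sh ^ ((1 : ℝ) / m) with hR
  have hR0 : 0 ≤ R := by positivity
  have hRm : R ^ m = Sh := by
    rw [hR, one_div]; exact Real.rpow_inv_natCast_pow hSh hm0
  have hDm : D ^ m = (m:ℝ) ^ m / δ := by
    rw [hD, div_pow, one_div, Real.rpow_inv_natCast_pow hδ.le hm0]
  have hsum : R ^ m + T ^ m ≤ (R + T) ^ m := pow_add_pow_le hR0 hTp.le hm0
  have hmain : |(n:ℝ) * y| ≤ D * (R + T) := by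
    refine le_of_pow_le_pow_left₀ hm0 (by positivity) ?_
    calc _ ≤ _ := hy
      _ ≤ 2 ^ M * (M : ℝ) ^ m / δ * (2 ^ M * Sh + 2 ^ M * T ^ m) := by
          gcongr; linarith
      _ = (m:ℝ) ^ m / δ * (R ^ m + T ^ m) := by
          have : (m:ℝ) ^ m = 2 ^ M * 2 ^ M * (M:ℝ) ^ m := by
            rw [hmM, mul_pow, ← pow_add]; congr 2; omega
          rw [this, hRm]; ring
      _ ≤ _ := by rw [mul_pow D (R + T) m, hDm]; gcongr
  rw [abs_mul, abs_of_pos hnp] at hmain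
  have h2 : |y| ≤ D * (R + T) / n := by
    rw [le_div_iff₀ hnp, mul_comm]; exact hmain
  refine h2.trans ?_
  have : D * (R + T) / n = D * (1 / n) * R + a * D * Lr * E1 := by
    rw [hT]; field_simp
  rw [this]
  gcongr
  linarith

/-- Corollary 1: with probability at least `1 - δ₁ - δ₂`,
`sup_i |p_i - p̂_i| ≤ (m/δ₁^{1/m})(1/n)(∑_{k=1}^{m/2} ∑_i (n p̂_i(1-p̂_i))^k)^{1/m}
 + a (m/δ₁^{1/m}) (log(1/δ₂))^{1/(2m)} ( n^{-(1/2)(1+1/m)} + 24 n^{-(1/2)(1+5/m)} )`,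
where `a = √(2 exp(1/e))`. -/
theorem stmt_5 (p : PMF ℕ) (n : ℕ) (hn : 2 ≤ n) (δ₁ δ₂ : ℝ) (hδ₁ : 0 < δ₁) (hδ₂ : 0 < δ₂)
    (m : ℕ) (hm : 0 < m) (hme : Even m) :
    ENNReal.ofReal (1 - δ₁ - δ₂) ≤
      sampleMeasure p n {x |
        (⨆ i : ℕ, |(p i).toReal - mle n x i|) ≤
          ((m : ℝ) / δ₁ ^ ((1 : ℝ) / m)) * (1 / n) *
              (∑ k ∈ Finset.Icc 1 (m / 2),
                  ∑' i : ℕ, ((n : ℝ) * (mle n x i * (1 - mle n x i))) ^ k) ^ ((1 : ℝ) / m) +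
            Real.sqrt (2 * Real.exp (1 / Real.exp 1)) * ((m : ℝ) / δ₁ ^ ((1 : ℝ) / m)) *
              (Real.log (1 / δ₂)) ^ ((1 : ℝ) / (2 * m)) *
              ((n : ℝ) ^ (-(1 / 2 : ℝ) * (1 + 1 / (m : ℝ))) +
                24 * (n : ℝ) ^ (-(1 / 2 : ℝ) * (1 + 5 / (m : ℝ))))} := by
  obtain ⟨M, hmM⟩ := hme
  obtain rfl : m = 2 * M := by omega
  have hM : 1 ≤ M := by omega
  rcases le_or_gt (1 - δ₁ - δ₂) 0 with hneg | hpos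
  · rw [ENNReal.ofReal_of_nonpos hneg]; exact zero_le
  have hδ₂1 : δ₂ < 1 := by linarith
  set L := Real.log (1 / δ₂) with hL
  have hLp : 0 < L := Real.log_pos (by rw [lt_div_iff₀ hδ₂]; linarith)
  set t : ℝ := M ^ 2 * (n:ℝ) ^ M * √(L / (2 * (n / 2 : ℕ))) with ht
  have hNp : (0:ℝ) < (n / 2 : ℕ) := by exact_mod_cast (by omega : 0 < n / 2)
  have hnp : (0:ℝ) < n := by exact_mod_cast (by omega : 0 < n)
  have hMp : (0:ℝ) < M := by exact_mod_cast hM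
  have h1 := good1 p n M hM δ₁ hδ₁
  have h2 := good2 p n M hn hM t (by positivity)
  have hexp : exp (- (2 * (n / 2 : ℕ) * t ^ 2 / (M ^ 2 * (n:ℝ) ^ M) ^ 2)) = δ₂ := by
    have : 2 * (n / 2 : ℕ) * t ^ 2 / (M ^ 2 * (n:ℝ) ^ M) ^ 2 = L := by
      rw [ht, mul_pow, Real.sq_sqrt (by positivity)]
      field_simp
    rw [this, hL, one_div, Real.log_inv, neg_neg, Real.exp_log hδ₂]
  rw [hexp] at h2
  have h2' : sampleMeasure p n {x | ¬ ∑' i, ff M (n * vv p i) ≤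
        2 ^ M * (∑' i, ff M (n * vh n x i)) + t} ≤ ENNReal.ofReal δ₂ := by
    rw [← ENNReal.ofReal_toReal (measure_ne_top (sampleMeasure p n) _)]
    exact ENNReal.ofReal_le_ofReal h2
  set B1 := {x | ¬ ∀ i, |Y p n i x| ^ (2 * M) ≤
        2 ^ M * (M : ℝ) ^ (2 * M) / δ₁ * ∑' i, ff M (n * vv p i)} with hB1
  set B2 := {x : Fin n → ℕ | ¬ ∑' i, ff M (n * vv p i) ≤
        2 ^ M * (∑' i, ff M (n * vh n x i)) + t} with hB2
  have hprob : ENNReal.ofReal (1 - δ₁ - δ₂) ≤ sampleMeasure p n (B1 ∪ B2)ᶜ := by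
    rw [prob_compl_eq_one_sub (.of_discrete), sub_sub, ENNReal.ofReal_sub _ (by positivity),
      ENNReal.ofReal_one, ENNReal.ofReal_add hδ₁.le hδ₂.le]
    exact tsub_le_tsub_left ((measure_union_le _ _).trans (add_le_add h1 h2')) _
  refine hprob.trans (measure_mono ?_)
  intro x hx
  rw [Set.mem_compl_iff, Set.mem_union, not_or] at hx
  obtain ⟨hx1, hx2⟩ := hx
  simp only [hB1, hB2, Set.mem_ofPred_eq, not_not] at hx1 hx2
  simp only [Set.mem_ofPred_eq]
  have hM2 : 2 * M / 2 = M := by omega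
  have hsum : ∑ k ∈ Finset.Icc 1 (2 * M / 2),
      ∑' i : ℕ, ((n : ℝ) * (mle n x i * (1 - mle n x i))) ^ k = ∑' i, ff M (n * vh n x i) := by
    rw [hM2]
    unfold ff
    rw [Summable.tsum_finsetSum]
    · rfl
    · intro k hk
      rw [Finset.mem_Icc] at hk
      refine summable_of_ne_finset_zero (s := Finset.univ.image x) fun i hi => ?_
      rw [vh_zero n x i hi, mul_zero, zero_pow (by omega)]
  rw [hsum]
  refine ciSup_le fun i => ?_
  refine final_real n M hn hM δ₁ L t (∑' i, ff M (n * vv p i)) _ _ hδ₁ hLp ht ?_ hx2 ?_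
  · refine tsum_nonneg fun i => ?_
    unfold ff
    exact Finset.sum_nonneg fun k _ => by have := vh_nonneg n x i; positivity
  · have := hx1 i
    rw [Y_eq p n (by omega), ← abs_neg, ← mul_neg, neg_sub] at this
    exact this
end

section
/- Let p = (p_i)_{i∈ℕ} be a probability distribution on ℕ. Put v_i = p_i(1−p_i), v* = sup_{i∈ℕ} v_i, and V* = sup_{i∈ℕ} v_i(p↓)·log(i+1) where p↓ is a nonincreasing rearrangement of p. Then V*(p) ≤ φ(v*(p)) = v*·log(1/v*). -/
noncomputable def vstar (p : PMF ℕ) : ℝ :=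
  ⨆ i : ℕ, (p i).toReal * (1 - (p i).toReal)

/-- `V*(p)` computed from a nonincreasing rearrangement `i ↦ p (e i)` of `p`
(indices are 0-based, so the `i`-th largest mass gets weight `log (i+2)`). -/
noncomputable def Vstar (p : PMF ℕ) (e : ℕ ≃ ℕ) : ℝ :=
  ⨆ i : ℕ, ((p (e i)).toReal * (1 - (p (e i)).toReal)) * Real.log ((i : ℝ) + 2)

theorem aux_phi {a b : ℝ} (ha : 0 < a) (hab : a ≤ b) (hb : b ≤ 1 / 4) :
    a * Real.log (1 / a) ≤ b * Real.log (1 / b) := by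
  have hb0 : 0 < b := ha.trans_le hab
  have h1 := Real.log_le_sub_one_of_pos (div_pos hb0 ha)
  rw [Real.log_div hb0.ne' ha.ne'] at h1
  have h2 : a * (Real.log b - Real.log a) ≤ b - a := by
    have := mul_le_mul_of_nonneg_left h1 ha.le
    have h3 : a * (b / a - 1) = b - a := by field_simp
    linarith
  have h4 : Real.log b ≤ -1 := by
    rw [Real.log_le_iff_le_exp hb0, Real.exp_neg]
    have h5 := Real.exp_one_lt_d9
    have : (1 / 4 : ℝ) ≤ (Real.exp 1)⁻¹ := by
      rw [one_div]
      exact inv_anti₀ (Real.exp_pos 1) (by linarith)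
    linarith
  rw [one_div, one_div, Real.log_inv, Real.log_inv]
  nlinarith [mul_nonneg (sub_nonneg.2 hab) (by linarith : 0 ≤ -1 - Real.log b)]

theorem aux_sum (p : PMF ℕ) (e : ℕ ≃ ℕ) (he : Antitone fun i => (p (e i)).toReal) (i : ℕ) :
    ((i : ℝ) + 1) * (p (e i)).toReal ≤ 1 := by
  have h1 : ∑ j ∈ Finset.range (i + 1), p (e j) ≤ 1 := by
    rw [← p.tsum_coe, ← e.tsum_eq (fun j => p j)]
    exact ENNReal.sum_le_tsum _
  have h2 : ∑ j ∈ Finset.range (i + 1), (p (e j)).toReal ≤ 1 := by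
    rw [← ENNReal.toReal_sum (fun j _ => p.apply_ne_top _)]
    exact ENNReal.toReal_le_of_le_ofReal zero_le_one (by simpa using h1)
  have h3 : ∑ j ∈ Finset.range (i + 1), (p (e i)).toReal
      ≤ ∑ j ∈ Finset.range (i + 1), (p (e j)).toReal :=
    Finset.sum_le_sum fun j hj => he (by simpa [Nat.lt_succ_iff] using hj)
  simp at h3
  linarith

/-- Lemma 2: `V*(p) ≤ φ(v*(p)) = v* log(1/v*)`. -/
theorem stmt_11 (p : PMF ℕ) (e : ℕ ≃ ℕ) (he : Antitone fun i => (p (e i)).toReal) :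
    Vstar p e ≤ vstar p * Real.log (1 / vstar p) := by
  have hq : ∀ x : ℝ, x * (1 - x) ≤ 1 / 4 := fun x => by nlinarith [sq_nonneg (x - 1 / 2)]
  have hv : vstar p ≤ 1 / 4 := ciSup_le fun i => hq _
  have hle : ∀ i, (p i).toReal * (1 - (p i).toReal) ≤ vstar p := fun i =>
    le_ciSup (f := fun i => (p i).toReal * (1 - (p i).toReal))
      ⟨1 / 4, by rintro _ ⟨i, rfl⟩; exact hq _⟩ i
  have h1 : ∀ i, (p i).toReal ≤ 1 := fun i =>
    ENNReal.toReal_le_of_le_ofReal zero_le_one (by simpa using p.coe_le_one i)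
  have hnn : ∀ i, 0 ≤ (p i).toReal * (1 - (p i).toReal) := fun i =>
    mul_nonneg ENNReal.toReal_nonneg (sub_nonneg.2 (h1 i))
  refine ciSup_le fun i => ?_
  have hs := aux_sum p e he i
  have hl := hle (e i)
  have hn := hnn (e i)
  have hq1 := h1 (e i)
  have hq0 : 0 ≤ (p (e i)).toReal := ENNReal.toReal_nonneg
  generalize (p (e i)).toReal = q at *
  rcases hn.eq_or_lt with h0 | h0
  · rw [← h0, zero_mul]
    have hv0 : 0 ≤ vstar p := hn.trans hl
    rcases hv0.eq_or_lt with h | h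
    · rw [← h]; simp
    · exact mul_nonneg hv0 (Real.log_nonneg (by rw [le_div_iff₀ h]; linarith))
  · refine le_trans ?_ (aux_phi h0 hl hv)
    refine mul_le_mul_of_nonneg_left (Real.log_le_log (by positivity) ?_) hn
    rw [le_div_iff₀ h0]
    nlinarith [mul_nonneg (sub_nonneg.2 hs) (sub_nonneg.2 hq1)]
end

section
/- There exists an absolute constant c > 0 such that for every probability distribution p = (p_i)_{i∈ℕ} on ℕ, if for each n the estimator p̂ is the maximum likelihood estimator based on n i.i.d. samples from p, then liminf_{n→∞} √n · E[ sup_{i∈ℕ} |p_i − p̂_i| ] ≥ c·√(V*(p)), where V*(p) = sup_{i∈ℕ} v_i(p↓)·log(i+1), v_i = p_i(1−p_i), and p↓ is a nonincreasing rearrangement of p. -/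
open MeasureTheory Real Filter

namespace S17

instance instProb (p : PMF ℕ) (n : ℕ) : IsProbabilityMeasure (sampleMeasure p n) := by
  unfold sampleMeasure; infer_instance

noncomputable def q (p : PMF ℕ) (j : ℕ) : ℝ := (p j).toReal
noncomputable def v (p : PMF ℕ) (j : ℕ) : ℝ := q p j * (1 - q p j)
noncomputable def z (p : PMF ℕ) (j : ℕ) (x : ℕ) : ℝ := (if x = j then 1 else 0) - q p j
noncomputable def Y (p : PMF ℕ) (n j : ℕ) (x : Fin n → ℕ) : ℝ := ∑ t, z p j (x t)

lemma q_nonneg (p : PMF ℕ) (j : ℕ) : 0 ≤ q p j := ENNReal.toReal_nonneg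
lemma q_le_one (p : PMF ℕ) (j : ℕ) : q p j ≤ 1 := by
  unfold q
  exact ENNReal.toReal_le_of_le_ofReal zero_le_one (by simpa using p.coe_le_one j)
lemma v_nonneg (p : PMF ℕ) (j : ℕ) : 0 ≤ v p j :=
  mul_nonneg (q_nonneg p j) (by linarith [q_le_one p j])
lemma v_le_q (p : PMF ℕ) (j : ℕ) : v p j ≤ q p j := by
  unfold v; nlinarith [q_nonneg p j]
lemma z_abs (p : PMF ℕ) (j x : ℕ) : |z p j x| ≤ 1 := by
  have := q_nonneg p j
  have := q_le_one p j
  unfold z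
  split_ifs <;> rw [abs_le] <;> constructor <;> linarith

lemma integ_p (p : PMF ℕ) (f : ℕ → ℝ) (C : ℝ) (h : ∀ x, |f x| ≤ C) :
    Integrable f p.toMeasure :=
  Integrable.of_bound (Measurable.of_discrete.aestronglyMeasurable) C
    (ae_of_all _ (fun x => by simpa using h x))

lemma integ_mu (p : PMF ℕ) (n : ℕ) (f : (Fin n → ℕ) → ℝ) (C : ℝ) (h : ∀ x, |f x| ≤ C) :
    Integrable f (sampleMeasure p n) :=
  Integrable.of_bound (Measurable.of_discrete.aestronglyMeasurable) C
    (ae_of_all _ (fun x => by simpa using h x))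

lemma prod_bound (n : ℕ) (g : ℕ → ℝ) (C : ℝ) (h : ∀ x, |g x| ≤ C) (x : Fin n → ℕ) :
    |∏ t, g (x t)| ≤ C ^ n := by
  rw [Finset.abs_prod]
  calc ∏ t, |g (x t)| ≤ ∏ _t : Fin n, C :=
        Finset.prod_le_prod (fun _ _ => abs_nonneg _) (fun t _ => h (x t))
    _ = C ^ n := by simp

lemma prod_int (p : PMF ℕ) (n : ℕ) (g : ℕ → ℝ) :
    ∫ x, ∏ t, g (x t) ∂(sampleMeasure p n) = (∫ x, g x ∂p.toMeasure) ^ n := by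
  unfold sampleMeasure
  rw [integral_fintype_prod_eq_pow]
  simp

lemma int_ind (p : PMF ℕ) (j : ℕ) :
    ∫ x, (if x = j then (1:ℝ) else 0) ∂p.toMeasure = q p j := by
  have : (fun x => if x = j then (1:ℝ) else 0) = Set.indicator {j} (fun _ => (1:ℝ)) := by
    ext x; simp [Set.indicator]
  rw [this, integral_indicator_const _ (measurableSet_singleton j)]
  simp [Measure.real, PMF.toMeasure_apply_singleton, q]

lemma integ_z (p : PMF ℕ) (j : ℕ) : Integrable (z p j) p.toMeasure :=
  integ_p p _ 1 (z_abs p j)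

lemma int_z (p : PMF ℕ) (j : ℕ) : ∫ x, z p j x ∂p.toMeasure = 0 := by
  unfold z
  rw [integral_sub, int_ind]
  · simp
  · exact integ_p p _ 1 (fun x => by split_ifs <;> simp)
  · exact integrable_const _

lemma z_sq (p : PMF ℕ) (j x : ℕ) : (z p j x)^2 = v p j + (1 - 2 * q p j) * z p j x := by
  unfold z v; split_ifs <;> ring

lemma int_z_sq (p : PMF ℕ) (j : ℕ) : ∫ x, (z p j x)^2 ∂p.toMeasure = v p j := by
  simp_rw [z_sq]
  rw [integral_add (integrable_const _) ((integ_z p j).const_mul _), integral_const_mul, int_z]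
  simp

lemma z_mul (p : PMF ℕ) {j k : ℕ} (h : j ≠ k) (x : ℕ) :
    z p j x * z p k x = -(q p j * q p k) - q p k * z p j x - q p j * z p k x := by
  unfold z
  by_cases h1 : x = j
  · have h2 : x ≠ k := fun h' => h (h1.symm.trans h')
    rw [if_pos h1, if_neg h2]; ring
  · rw [if_neg h1]; ring

lemma int_z_mul (p : PMF ℕ) {j k : ℕ} (h : j ≠ k) :
    ∫ x, z p j x * z p k x ∂p.toMeasure = -(q p j * q p k) := by
  simp_rw [z_mul p h]
  have hi : Integrable (fun x => -(q p j * q p k) - q p k * z p j x) p.toMeasure :=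
    (integrable_const _).sub ((integ_z p j).const_mul _)
  rw [integral_sub hi ((integ_z p k).const_mul _),
    integral_sub (integrable_const _) ((integ_z p j).const_mul _),
    integral_const_mul, integral_const_mul, int_z, int_z]
  simp

lemma exp_quad {x : ℝ} (h : |x| ≤ 1) : exp x ≤ 1 + x + x^2 := by
  have := (abs_le.1 (Real.abs_exp_sub_one_sub_id_le h)).2
  linarith

lemma rz_abs (p : PMF ℕ) (j : ℕ) {r : ℝ} (hr : |r| ≤ 1) (x : ℕ) : |r * z p j x| ≤ 1 := by
  rw [abs_mul]; exact mul_le_one₀ hr (abs_nonneg _) (z_abs p j x)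

lemma exp_rz_le (p : PMF ℕ) (j : ℕ) {r : ℝ} (hr : |r| ≤ 1) (x : ℕ) :
    |exp (r * z p j x)| ≤ exp 1 := by
  rw [abs_of_pos (exp_pos _)]
  exact exp_le_exp.2 ((le_abs_self _).trans (rz_abs p j hr x))

lemma int_exp (p : PMF ℕ) (j : ℕ) {r : ℝ} (hr : |r| ≤ 1) :
    ∫ x, exp (r * z p j x) ∂p.toMeasure ≤ exp (r^2 * v p j) := by
  have h1 : ∫ x, exp (r * z p j x) ∂p.toMeasure ≤
      ∫ x, (1 + r^2 * v p j + (r + r^2 * (1 - 2 * q p j)) * z p j x) ∂p.toMeasure := by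
    apply integral_mono
    · exact integ_p p _ _ (exp_rz_le p j hr)
    · exact (integrable_const _).add ((integ_z p j).const_mul _)
    · intro x
      have := exp_quad (rz_abs p j hr x)
      rw [mul_pow, z_sq] at this
      simp only
      linarith
  rw [integral_add (integrable_const _) ((integ_z p j).const_mul _), integral_const_mul,
    int_z] at h1
  have := Real.add_one_le_exp (r^2 * v p j)
  simp at h1
  linarith

lemma exp_Y (p : PMF ℕ) (n j : ℕ) (r : ℝ) (x : Fin n → ℕ) :
    exp (r * Y p n j x) = ∏ t, exp (r * z p j (x t)) := by
  unfold Y; rw [Finset.mul_sum, Real.exp_sum]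

lemma int_exp_Y (p : PMF ℕ) (n j : ℕ) {r : ℝ} (hr : |r| ≤ 1) :
    ∫ x, exp (r * Y p n j x) ∂(sampleMeasure p n) ≤ exp (n * (r^2 * v p j)) := by
  simp_rw [exp_Y]
  rw [prod_int p n (fun y => exp (r * z p j y)), Real.exp_nat_mul]
  exact pow_le_pow_left₀ (integral_nonneg (fun _ => (exp_pos _).le)) (int_exp p j hr) n

lemma integ_exp_Y (p : PMF ℕ) (n j : ℕ) {r : ℝ} (hr : |r| ≤ 1) :
    Integrable (fun x => exp (r * Y p n j x)) (sampleMeasure p n) := by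
  simp_rw [exp_Y]
  exact integ_mu p n _ _ (prod_bound n (fun y => exp (r * z p j y)) _ (exp_rz_le p j hr))

lemma Y_eq (p : PMF ℕ) {n : ℕ} (hn : 0 < n) (j : ℕ) (x : Fin n → ℕ) :
    (p j).toReal - mle n x j = - (Y p n j x / n) := by
  have : (n:ℝ) ≠ 0 := by positivity
  unfold mle Y z
  rw [Finset.sum_sub_distrib]
  simp [q]
  field_simp
  ring

lemma Y_abs (p : PMF ℕ) (n j : ℕ) (x : Fin n → ℕ) : |Y p n j x| ≤ n := by
  unfold Y
  calc _ ≤ ∑ t, |z p j (x t)| := Finset.abs_sum_le_sum_abs _ _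
    _ ≤ ∑ t : Fin n, (1:ℝ) := Finset.sum_le_sum (fun t _ => z_abs p j (x t))
    _ = n := by simp

noncomputable def M (p : PMF ℕ) (n : ℕ) (x : Fin n → ℕ) : ℝ := ⨆ i : ℕ, |(p i).toReal - mle n x i|

lemma term_le (p : PMF ℕ) {n : ℕ} (hn : 0 < n) (x : Fin n → ℕ) (i : ℕ) :
    |(p i).toReal - mle n x i| ≤ 1 := by
  have : (0:ℝ) < n := by positivity
  rw [Y_eq p hn, abs_neg, abs_div, abs_of_pos this, div_le_one this]
  exact Y_abs p n i x

lemma M_le (p : PMF ℕ) {n : ℕ} (hn : 0 < n) (x : Fin n → ℕ) : M p n x ≤ 1 :=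
  ciSup_le (term_le p hn x)
lemma M_nonneg (p : PMF ℕ) (n : ℕ) (x : Fin n → ℕ) : 0 ≤ M p n x :=
  Real.iSup_nonneg (fun _ => abs_nonneg _)
lemma le_M (p : PMF ℕ) {n : ℕ} (hn : 0 < n) (x : Fin n → ℕ) (j : ℕ) : |Y p n j x| / n ≤ M p n x := by
  have h := le_ciSup (f := fun i : ℕ => |(p i).toReal - mle n x i|)
    ⟨1, by rintro _ ⟨i, rfl⟩; exact term_le p hn x i⟩ j
  rw [Y_eq p hn, abs_neg, abs_div, Nat.abs_cast] at h
  exact h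
lemma integ_M (p : PMF ℕ) {n : ℕ} (hn : 0 < n) : Integrable (M p n) (sampleMeasure p n) :=
  integ_mu p n _ 1 (fun x => by rw [abs_of_nonneg (M_nonneg p n x)]; exact M_le p hn x)

/-- second moment -/
lemma int_Y_sq (p : PMF ℕ) {n : ℕ} (hn : 0 < n) (j : ℕ) :
    ∫ x, (Y p n j x)^2 / n ∂(sampleMeasure p n) ≤ 4 * q p j := by
  have hn' : (0:ℝ) < n := by positivity
  set r : ℝ := 1 / √n with hr
  have hr2 : r^2 = 1 / n := by rw [hr, div_pow, Real.sq_sqrt hn'.le]; simp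
  have hr0 : 0 ≤ r := by positivity
  have hr1 : |r| ≤ 1 := by
    rw [abs_of_nonneg hr0, hr, div_le_one (by positivity)]
    exact Real.one_le_sqrt.2 (by exact_mod_cast hn)
  have hr1' : |(-r)| ≤ 1 := by rwa [abs_neg]
  have hv : v p j ≤ 1 := (v_le_q p j).trans (q_le_one p j)
  have key : ∀ u : ℝ, u^2 ≤ exp u + exp (-u) - 2 := by
    intro u
    have h : (u/2)^2 ≤ (Real.sinh (u/2))^2 := by
      rw [← sq_abs (u/2), ← sq_abs (Real.sinh (u/2)), Real.abs_sinh]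
      exact pow_le_pow_left₀ (abs_nonneg _) (Real.self_le_sinh_iff.2 (abs_nonneg _)) 2
    have h2 : exp u + exp (-u) - 2 = 4 * (Real.sinh (u/2))^2 := by
      have e1 : exp u = exp (u/2) ^ 2 := by rw [← Real.exp_nat_mul]; congr 1; push_cast; ring
      have e2 : exp (-u) = exp (-(u/2)) ^ 2 := by
        rw [← Real.exp_nat_mul]; congr 1; push_cast; ring
      have e3 : exp (u/2) * exp (-(u/2)) = 1 := by rw [← Real.exp_add]; simp
      rw [Real.sinh_eq, e1, e2]
      linear_combination 2 * e3
    rw [h2]; linarith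
  have h1 := int_exp_Y p n j hr1
  have h2 := int_exp_Y p n j hr1'
  have hE : exp (v p j) ≤ 1 + 2 * v p j := by
    have := exp_quad (x := v p j) (by rw [abs_of_nonneg (v_nonneg p j)]; exact hv)
    nlinarith [v_nonneg p j]
  have e1 : (n:ℝ) * (r^2 * v p j) = v p j := by rw [hr2]; field_simp
  have e2 : (n:ℝ) * ((-r)^2 * v p j) = v p j := by rw [neg_sq, e1]
  rw [e1] at h1; rw [e2] at h2
  calc ∫ x, (Y p n j x)^2 / n ∂(sampleMeasure p n)
      ≤ ∫ x, (exp (r * Y p n j x) + exp ((-r) * Y p n j x) - 2) ∂(sampleMeasure p n) := by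
        apply integral_mono
        · apply integ_mu p n _ n
          intro x
          have := Y_abs p n j x
          rw [abs_div, abs_pow, Nat.abs_cast, div_le_iff₀ hn', pow_two]
          exact mul_self_le_mul_self (abs_nonneg _) this
        · exact ((integ_exp_Y p n j hr1).add (integ_exp_Y p n j hr1')).sub (integrable_const _)
        · intro x
          have := key (r * Y p n j x)
          rw [mul_pow, hr2] at this
          simp only [neg_mul]
          calc _ = _ := by ring
            _ ≤ _ := this
    _ ≤ _ := by
        have hi : Integrable (fun x => exp (r * Y p n j x) + exp ((-r) * Y p n j x))
            (sampleMeasure p n) := (integ_exp_Y p n j hr1).add (integ_exp_Y p n j hr1')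
        rw [integral_sub hi (integrable_const _),
          integral_add (integ_exp_Y p n j hr1) (integ_exp_Y p n j hr1')]
        simp
        simp only [neg_mul] at h2
        linarith [v_le_q p j]

lemma upper (p : PMF ℕ) {n : ℕ} (hn : 0 < n) :
    √n * ∫ x, M p n x ∂(sampleMeasure p n) ≤ 5 := by
  have hn' : (0:ℝ) < n := by positivity
  rw [← integral_const_mul, integral_eq_lintegral_of_nonneg_ae
    (ae_of_all _ (fun x => mul_nonneg (Real.sqrt_nonneg _) (M_nonneg p n x)))
    (Measurable.of_discrete.aestronglyMeasurable)]
  apply ENNReal.toReal_le_of_le_ofReal (by norm_num)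
  calc ∫⁻ x, ENNReal.ofReal (√n * M p n x) ∂(sampleMeasure p n)
      ≤ ∫⁻ x, (1 + ∑' j, ENNReal.ofReal ((Y p n j x)^2 / n)) ∂(sampleMeasure p n) := by
        apply lintegral_mono
        intro x
        simp only
        set T := ∑' j, ENNReal.ofReal ((Y p n j x)^2 / n) with hT
        by_cases hTt : 1 + T = ⊤
        · rw [hTt]; exact le_top
        rw [ENNReal.ofReal_le_iff_le_toReal hTt]
        have hs : (0:ℝ) < √n := by positivity
        rw [← le_div_iff₀' hs]
        apply ciSup_le
        intro i
        rw [le_div_iff₀' hs, ← ENNReal.ofReal_le_iff_le_toReal hTt, Y_eq p hn, abs_neg, abs_div,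
          Nat.abs_cast]
        calc ENNReal.ofReal (√n * (|Y p n i x| / n))
            ≤ ENNReal.ofReal (1 + (Y p n i x)^2 / n) := by
              apply ENNReal.ofReal_le_ofReal
              have h1 : √n * (|Y p n i x| / n) = |Y p n i x| / √n := by
                rw [mul_div_assoc', mul_comm, div_eq_div_iff hn'.ne' hs.ne', mul_assoc,
                  Real.mul_self_sqrt hn'.le]
              have h2 : (Y p n i x)^2 / n = (|Y p n i x| / √n)^2 := by
                rw [div_pow, Real.sq_sqrt hn'.le, sq_abs]
              rw [h1, h2]
              nlinarith [sq_nonneg (|Y p n i x| / √n - 1), sq_nonneg (|Y p n i x| / √n)]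
          _ = 1 + ENNReal.ofReal ((Y p n i x)^2 / n) := by
              rw [ENNReal.ofReal_add zero_le_one (by positivity)]; simp
          _ ≤ 1 + T := by
              gcongr
              exact ENNReal.le_tsum (f := fun j => ENNReal.ofReal ((Y p n j x)^2 / n)) i
    _ = 1 + ∑' j, ∫⁻ x, ENNReal.ofReal ((Y p n j x)^2 / n) ∂(sampleMeasure p n) := by
        rw [lintegral_add_left measurable_const, lintegral_tsum]
        · simp
        · intro i; exact Measurable.of_discrete.aemeasurable
    _ ≤ 1 + ∑' j, 4 * p j := by
        gcongr with j
        rw [← ofReal_integral_eq_lintegral_ofReal]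
        · have h := ENNReal.ofReal_le_ofReal (int_Y_sq p hn j)
          rw [ENNReal.ofReal_mul (by norm_num), q, ENNReal.ofReal_toReal (p.apply_ne_top j)] at h
          simpa using h
        · apply integ_mu p n _ n
          intro x
          have := Y_abs p n j x
          rw [abs_div, abs_pow, Nat.abs_cast, div_le_iff₀ hn', pow_two]
          exact mul_self_le_mul_self (abs_nonneg _) this
        · exact ae_of_all _ (fun x => by simp only [Pi.zero_apply]; positivity)
    _ = ENNReal.ofReal 5 := by
        rw [ENNReal.tsum_mul_left, p.tsum_coe]
        norm_num

noncomputable def Lr (p : PMF ℕ) (n j : ℕ) (s : ℝ) (x : Fin n → ℕ) : ℝ :=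
  ∏ t, (1 + s * z p j (x t))

lemma fac_nonneg (p : PMF ℕ) (j : ℕ) {s : ℝ} (hs : |s| ≤ 1) (x : ℕ) : 0 ≤ 1 + s * z p j x := by
  have := (abs_le.1 (rz_abs p j hs x)).1; linarith

lemma fac_le (p : PMF ℕ) (j : ℕ) {s : ℝ} (hs : |s| ≤ 1) (x : ℕ) : |1 + s * z p j x| ≤ 2 := by
  rw [abs_of_nonneg (fac_nonneg p j hs x)]
  have := (abs_le.1 (rz_abs p j hs x)).2; linarith

lemma Lr_nonneg (p : PMF ℕ) (n j : ℕ) {s : ℝ} (hs : |s| ≤ 1) (x : Fin n → ℕ) : 0 ≤ Lr p n j s x :=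
  Finset.prod_nonneg (fun t _ => fac_nonneg p j hs (x t))

lemma Lr_le (p : PMF ℕ) (n j : ℕ) {s : ℝ} (hs : |s| ≤ 1) (x : Fin n → ℕ) :
    |Lr p n j s x| ≤ 2 ^ n := prod_bound n (fun y => 1 + s * z p j y) 2 (fac_le p j hs) x

lemma int_Lr (p : PMF ℕ) (n j : ℕ) (s : ℝ) :
    ∫ x, Lr p n j s x ∂(sampleMeasure p n) = 1 := by
  unfold Lr
  rw [prod_int p n (fun y => 1 + s * z p j y),
    integral_add (integrable_const _) ((integ_z p j).const_mul _), integral_const_mul, int_z]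
  simp

lemma int_Lr_mul (p : PMF ℕ) (n : ℕ) {j k : ℕ} (h : j ≠ k) {s s' : ℝ} (hs : |s| ≤ 1)
    (hs' : |s'| ≤ 1) (hs0 : 0 ≤ s) (hs0' : 0 ≤ s') :
    ∫ x, Lr p n j s x * Lr p n k s' x ∂(sampleMeasure p n) ≤ 1 := by
  unfold Lr
  simp_rw [← Finset.prod_mul_distrib]
  rw [prod_int p n (fun y => (1 + s * z p j y) * (1 + s' * z p k y))]
  apply pow_le_one₀
  · exact integral_nonneg (fun y => mul_nonneg (fac_nonneg p j hs y) (fac_nonneg p k hs' y))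
  · have e : ∀ y, (1 + s * z p j y) * (1 + s' * z p k y) =
        (1 - s * s' * (q p j * q p k)) + (s - s * s' * q p k) * z p j y
          + (s' - s * s' * q p j) * z p k y := by
      intro y
      linear_combination (s * s') * z_mul p h y
    simp_rw [e]
    have hi : Integrable (fun y => (1 - s * s' * (q p j * q p k))
        + (s - s * s' * q p k) * z p j y) p.toMeasure :=
      (integrable_const _).add ((integ_z p j).const_mul _)
    rw [integral_add hi ((integ_z p k).const_mul _),
      integral_add (integrable_const _) ((integ_z p j).const_mul _), integral_const_mul,
      integral_const_mul, int_z, int_z]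
    have := q_nonneg p j
    have := q_nonneg p k
    have : 0 ≤ s * s' * (q p j * q p k) := by positivity
    simpa using this

lemma int_Lr_sq (p : PMF ℕ) (n j : ℕ) {s : ℝ} :
    ∫ x, Lr p n j s x * Lr p n j s x ∂(sampleMeasure p n) ≤ exp (n * (s^2 * v p j)) := by
  unfold Lr
  simp_rw [← Finset.prod_mul_distrib]
  rw [prod_int p n (fun y => (1 + s * z p j y) * (1 + s * z p j y)), Real.exp_nat_mul]
  apply pow_le_pow_left₀
  · exact integral_nonneg (fun y => mul_self_nonneg _)
  · have e : ∀ y, (1 + s * z p j y) * (1 + s * z p j y) =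
        (1 + s^2 * v p j) + (2 * s + s^2 * (1 - 2 * q p j)) * z p j y := by
      intro y
      linear_combination (s^2) * z_sq p j y
    simp_rw [e]
    rw [integral_add (integrable_const _) ((integ_z p j).const_mul _), integral_const_mul, int_z]
    have := Real.add_one_le_exp (s^2 * v p j)
    simp
    linarith

lemma tail_fac (p : PMF ℕ) (j : ℕ) {s r : ℝ} (hs0 : 0 ≤ s) (hs1 : s ≤ 1) (hr : |r| ≤ 1) :
    ∫ y, (1 + s * z p j y) * exp (-r * z p j y) ∂p.toMeasure ≤
      exp (v p j * (2 * r^2 - r * s)) := by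
  have hs : |s| ≤ 1 := by rwa [abs_of_nonneg hs0]
  have hr' : |(-r)| ≤ 1 := by rwa [abs_neg]
  have h1 : ∫ y, (1 + s * z p j y) * exp (-r * z p j y) ∂p.toMeasure ≤
      ∫ y, ((1 + (2 * r^2 - r * s) * v p j) +
        (s - r + (2 * r^2 - r * s) * (1 - 2 * q p j)) * z p j y) ∂p.toMeasure := by
    apply integral_mono
    · apply integ_p p _ (2 * exp 1)
      intro y
      rw [abs_mul]
      exact mul_le_mul (fac_le p j hs y) (exp_rz_le p j hr' y) (abs_nonneg _) (by norm_num)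
    · exact (integrable_const _).add ((integ_z p j).const_mul _)
    · intro y
      simp only
      have h2 := mul_le_mul_of_nonneg_left (exp_quad (rz_abs p j hr' y)) (fac_nonneg p j hs y)
      refine h2.trans ?_
      have h3 := z_sq p j y
      have h4 : s * z p j y ≤ 1 := (abs_le.1 (rz_abs p j hs y)).2
      have h5 : 0 ≤ r^2 * (z p j y)^2 * (1 - s * z p j y) := by
        have : 0 ≤ 1 - s * z p j y := by linarith
        positivity
      have h6 : (1 + s * z p j y) * (1 + -r * z p j y + (-r * z p j y)^2) =
        1 + (s - r) * z p j y + (2 * r^2 - r * s) * (z p j y)^2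
          - r^2 * (z p j y)^2 * (1 - s * z p j y) := by ring
      have h7 : (2 * r^2 - r * s) * (z p j y)^2 = (2 * r^2 - r * s) * (v p j + (1 - 2 * q p j) * z p j y) := by
        rw [h3]
      rw [h6]
      linarith
  rw [integral_add (integrable_const _) ((integ_z p j).const_mul _), integral_const_mul,
    int_z] at h1
  have := Real.add_one_le_exp (v p j * (2 * r^2 - r * s))
  simp only [neg_mul] at h1 ⊢
  simp at h1
  linarith

lemma tail (p : PMF ℕ) (n j : ℕ) {s r : ℝ} (hs0 : 0 ≤ s) (hs1 : s ≤ 1) (hr : |r| ≤ 1) :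
    Integrable (fun x => Lr p n j s x * exp (-r * Y p n j x)) (sampleMeasure p n) ∧
    ∫ x, Lr p n j s x * exp (-r * Y p n j x) ∂(sampleMeasure p n) ≤
      exp (n * (v p j * (2 * r^2 - r * s))) := by
  have hs : |s| ≤ 1 := by rwa [abs_of_nonneg hs0]
  have hr' : |(-r)| ≤ 1 := by rwa [abs_neg]
  unfold Lr
  simp_rw [exp_Y, ← Finset.prod_mul_distrib]
  constructor
  · apply integ_mu p n _ ((2 * exp 1)^n)
    apply prod_bound n (fun y => (1 + s * z p j y) * exp (-r * z p j y))
    intro y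
    rw [abs_mul]
    exact mul_le_mul (fac_le p j hs y) (exp_rz_le p j hr' y) (abs_nonneg _) (by norm_num)
  · rw [prod_int p n (fun y => (1 + s * z p j y) * exp (-r * z p j y)), Real.exp_nat_mul]
    exact pow_le_pow_left₀
      (integral_nonneg (fun y => mul_nonneg (fac_nonneg p j hs y) (exp_pos _).le))
      (tail_fac p j hs0 hs1 hr) n

open Classical in
noncomputable def IA (p : PMF ℕ) (n : ℕ) (S : Finset ℕ) (d : ℝ) (x : Fin n → ℕ) : ℝ :=
  if ∃ j ∈ S, d ≤ Y p n j x then 1 else 0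

lemma IA_nonneg (p : PMF ℕ) (n : ℕ) (S : Finset ℕ) (d : ℝ) (x : Fin n → ℕ) :
    0 ≤ IA p n S d x := by unfold IA; split_ifs <;> norm_num
lemma IA_sq (p : PMF ℕ) (n : ℕ) (S : Finset ℕ) (d : ℝ) (x : Fin n → ℕ) :
    IA p n S d x ^ 2 = IA p n S d x := by unfold IA; split_ifs <;> norm_num
lemma IA_abs (p : PMF ℕ) (n : ℕ) (S : Finset ℕ) (d : ℝ) (x : Fin n → ℕ) :
    |IA p n S d x| ≤ 1 := by unfold IA; split_ifs <;> norm_num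

lemma integ_LI (p : PMF ℕ) (n j : ℕ) (S : Finset ℕ) (d : ℝ) {s : ℝ} (hs : |s| ≤ 1) :
    Integrable (fun x => Lr p n j s x * IA p n S d x) (sampleMeasure p n) := by
  apply integ_mu p n _ (2^n * 1)
  intro x
  rw [abs_mul]
  exact mul_le_mul (Lr_le p n j hs x) (IA_abs p n S d x) (abs_nonneg _) (by positivity)

lemma LI_lower (p : PMF ℕ) (n : ℕ) (S : Finset ℕ) (d : ℝ) {j : ℕ} (hj : j ∈ S) {s : ℝ}
    (hs0 : 0 ≤ s) (hs1 : s ≤ 1) (hd : d ≤ n * s * v p j / 2) (hl : 32 ≤ n * (s^2 * v p j)) :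
    1 / 2 ≤ ∫ x, Lr p n j s x * IA p n S d x ∂(sampleMeasure p n) := by
  have hs : |s| ≤ 1 := by rwa [abs_of_nonneg hs0]
  have hr : |s / 8| ≤ 1 := by rw [abs_of_nonneg (by positivity)]; linarith
  obtain ⟨ti, tb⟩ := tail p n j hs0 hs1 hr
  set d' := n * s * v p j / 2 with hd'
  have h1 : ∫ x, (Lr p n j s x - exp (s / 8 * d') * (Lr p n j s x * exp (-(s/8) * Y p n j x)))
      ∂(sampleMeasure p n) ≤ ∫ x, Lr p n j s x * IA p n S d x ∂(sampleMeasure p n) := by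
    apply integral_mono
    · exact (integ_mu p n _ _ (Lr_le p n j hs)).sub (ti.const_mul _)
    · exact integ_LI p n j S d hs
    · intro x
      simp only
      have hL := Lr_nonneg p n j hs x
      have e : exp (s / 8 * d') * (Lr p n j s x * exp (-(s/8) * Y p n j x)) =
          Lr p n j s x * exp (s / 8 * (d' - Y p n j x)) := by
        rw [mul_left_comm, ← Real.exp_add]; congr 2; ring
      rw [e]
      unfold IA
      split_ifs with h
      · have := mul_nonneg hL (exp_pos (s / 8 * (d' - Y p n j x))).le
        linarith
      · push Not at h
        have h2 := h j hj
        have h3 : 1 ≤ exp (s / 8 * (d' - Y p n j x)) :=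
          Real.one_le_exp (mul_nonneg (by positivity) (by linarith))
        have := mul_le_mul_of_nonneg_left h3 hL
        linarith
  rw [integral_sub (integ_mu p n _ _ (Lr_le p n j hs)) (ti.const_mul _), integral_const_mul,
    int_Lr] at h1
  have h2 := mul_le_mul_of_nonneg_left tb (exp_pos (s / 8 * d')).le
  rw [← Real.exp_add] at h2
  have h3 : exp (s / 8 * d' + n * (v p j * (2 * (s/8)^2 - s/8 * s))) ≤ exp (-1) := by
    apply exp_le_exp.2
    have : s / 8 * d' + n * (v p j * (2 * (s/8)^2 - s/8 * s)) = -(n * (s^2 * v p j)) / 32 := by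
      rw [hd']; ring
    rw [this]; linarith
  have h4 : exp (-1) ≤ 1 / 2 := by
    rw [Real.exp_neg, one_div]
    apply inv_anti₀ (by norm_num)
    have := Real.add_one_le_exp (1:ℝ); linarith
  linarith

noncomputable def K : ℝ := 1 + exp 32

lemma K_pos : 0 < K := by unfold K; positivity

lemma prob_lower (p : PMF ℕ) (n : ℕ) (S : Finset ℕ) (hS : S.Nonempty) (d : ℝ) (s : ℕ → ℝ)
    (hs0 : ∀ j, 0 ≤ s j) (hs1 : ∀ j ∈ S, s j ≤ 1) (hd : ∀ j ∈ S, d ≤ n * s j * v p j / 2)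
    (hl : ∀ j ∈ S, n * (s j^2 * v p j) = 32 + log S.card) :
    1 / (4 * K) ≤ ∫ x, IA p n S d x ∂(sampleMeasure p n) := by
  have hK := K_pos
  have hm : (1:ℝ) ≤ S.card := by exact_mod_cast hS.card_pos
  have hm0 : (0:ℝ) < S.card := by linarith
  have hlog := Real.log_nonneg hm
  have hs : ∀ j ∈ S, |s j| ≤ 1 := fun j hj => by rw [abs_of_nonneg (hs0 j)]; exact hs1 j hj
  set W : (Fin n → ℕ) → ℝ := fun x => ∑ j ∈ S, Lr p n j (s j) x with hW
  have i1 : ∀ j ∈ S, ∀ k ∈ S, Integrable (fun x => Lr p n j (s j) x * Lr p n k (s k) x)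
      (sampleMeasure p n) := by
    intro j hj k hk
    apply integ_mu p n _ (2^n * 2^n)
    intro x
    rw [abs_mul]
    exact mul_le_mul (Lr_le p n j (hs j hj) x) (Lr_le p n k (hs k hk) x) (abs_nonneg _)
      (by positivity)
  have eW : ∀ x, W x ^ 2 = ∑ j ∈ S, ∑ k ∈ S, Lr p n j (s j) x * Lr p n k (s k) x := by
    intro x; rw [hW, pow_two, Finset.sum_mul_sum]
  have i2 : Integrable (fun x => W x ^ 2) (sampleMeasure p n) := by
    simp_rw [eW]
    exact integrable_finsetSum _ (fun j hj => integrable_finsetSum _ (fun k hk => i1 j hj k hk))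
  have b2 : ∫ x, W x ^ 2 ∂(sampleMeasure p n) ≤ S.card ^ 2 * K := by
    simp_rw [eW]
    rw [integral_finsetSum _ (fun j hj => integrable_finsetSum _ (fun k hk => i1 j hj k hk))]
    calc _ = ∑ j ∈ S, ∑ k ∈ S, ∫ x, Lr p n j (s j) x * Lr p n k (s k) x ∂(sampleMeasure p n) :=
          Finset.sum_congr rfl (fun j hj => integral_finsetSum _ (fun k hk => i1 j hj k hk))
      _ ≤ ∑ j ∈ S, ∑ k ∈ S, (1 + if j = k then exp 32 * S.card else 0) := by
          apply Finset.sum_le_sum; intro j hj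
          apply Finset.sum_le_sum; intro k hk
          split_ifs with h
          · subst h
            refine (int_Lr_sq p n j).trans ?_
            rw [hl j hj, Real.exp_add, Real.exp_log hm0]
            linarith
          · rw [add_zero]
            exact int_Lr_mul p n h (hs j hj) (hs k hk) (hs0 j) (hs0 k)
      _ = S.card ^ 2 * K := by
          have : ∀ j ∈ S, ∑ k ∈ S, (1 + if j = k then exp 32 * (S.card:ℝ) else 0) = S.card * K := by
            intro j hj
            rw [Finset.sum_add_distrib, Finset.sum_ite_eq, if_pos hj]
            simp [K]; ring
          rw [Finset.sum_congr rfl this]; simp; ring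
  have b1 : (S.card : ℝ) / 2 ≤ ∫ x, W x * IA p n S d x ∂(sampleMeasure p n) := by
    simp_rw [hW, Finset.sum_mul]
    rw [integral_finsetSum _ (fun j hj => integ_LI p n j S d (hs j hj))]
    calc (S.card : ℝ) / 2 = ∑ j ∈ S, (1/2 : ℝ) := by simp; ring
      _ ≤ _ := Finset.sum_le_sum (fun j hj => LI_lower p n S d hj (hs0 j) (hs1 j hj) (hd j hj)
          (by rw [hl j hj]; linarith))
  have iI : Integrable (IA p n S d) (sampleMeasure p n) := integ_mu p n _ 1 (IA_abs p n S d)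
  have b3 : ∫ x, W x * IA p n S d x ∂(sampleMeasure p n) ≤
      ∫ x, (1 / (4 * K * S.card) * W x ^ 2 + K * S.card * IA p n S d x) ∂(sampleMeasure p n) := by
    apply integral_mono
    · simp_rw [hW, Finset.sum_mul]
      exact integrable_finsetSum _ (fun j hj => integ_LI p n j S d (hs j hj))
    · exact (i2.const_mul _).add (iI.const_mul _)
    · intro x
      simp only
      have h : 0 ≤ 1 / (4 * K * S.card) * (W x - 2 * K * S.card * IA p n S d x)^2 := by positivity
      have e : 1 / (4 * K * S.card) * (W x - 2 * K * S.card * IA p n S d x)^2 =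
        1 / (4 * K * S.card) * W x ^ 2 + K * S.card * (IA p n S d x)^2 - W x * IA p n S d x := by
        field_simp; ring
      rw [e, IA_sq] at h
      linarith
  rw [integral_add (i2.const_mul _) (iI.const_mul _), integral_const_mul, integral_const_mul] at b3
  have b4 : 1 / (4 * K * S.card) * ∫ x, W x ^ 2 ∂(sampleMeasure p n) ≤ S.card / 4 := by
    calc _ ≤ 1 / (4 * K * S.card) * (S.card ^ 2 * K) :=
          mul_le_mul_of_nonneg_left b2 (by positivity)
      _ = _ := by field_simp
  set P := ∫ x, IA p n S d x ∂(sampleMeasure p n)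
  have b5 : (S.card:ℝ) / 4 ≤ K * S.card * P := by linarith
  rw [div_le_iff₀ (by positivity)]
  have b6 : (S.card:ℝ) * 1 ≤ S.card * (P * (4 * K)) := by linarith
  exact le_of_mul_le_mul_left b6 hm0

lemma M_lower (p : PMF ℕ) {n : ℕ} (hn : 0 < n) (S : Finset ℕ) (hS : S.Nonempty) (w : ℝ)
    (hw : 0 < w) (hv : ∀ j ∈ S, w ≤ v p j) (hnw : 32 + log S.card ≤ n * w) :
    1 / (8 * K) * √((32 + log S.card) * w) ≤ √n * ∫ x, M p n x ∂(sampleMeasure p n) := by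
  have hK := K_pos
  have hn' : (0:ℝ) < n := by positivity
  have hm : (1:ℝ) ≤ S.card := by exact_mod_cast hS.card_pos
  have hlog := Real.log_nonneg hm
  set l := 32 + log S.card with hl
  have hl0 : 0 < l := by linarith
  set d := √(n * (l * w)) / 2 with hd
  have hd0 : 0 ≤ d := by positivity
  have h := prob_lower p n S hS d (fun j => √(l / (n * v p j))) (fun j => Real.sqrt_nonneg _)
    (by
      intro j hj
      have := hv j hj
      refine Real.sqrt_le_one.2 ?_
      rw [div_le_one (mul_pos hn' (by linarith))]
      exact hnw.trans (mul_le_mul_of_nonneg_left this hn'.le))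
    (by
      intro j hj
      have h1 := hv j hj
      have hvj : 0 < v p j := by linarith
      have : n * √(l / (n * v p j)) * v p j = √(n * (l * v p j)) := by
        symm
        rw [Real.sqrt_eq_iff_mul_self_eq (by positivity) (by positivity)]
        have := Real.mul_self_sqrt (show 0 ≤ l / (n * v p j) by positivity)
        symm
        calc _ = n * v p j * (n * v p j) * (√(l / (n * v p j)) * √(l / (n * v p j))) := by ring
          _ = _ := by rw [this]; field_simp
      rw [this, hd]
      gcongr)
    (by
      intro j hj
      have h1 := hv j hj
      have hvj : 0 < v p j := by linarith
      rw [Real.sq_sqrt (by positivity)]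
      field_simp
      exact hl)
  have h2 : ∫ x, d / n * IA p n S d x ∂(sampleMeasure p n) ≤ ∫ x, M p n x ∂(sampleMeasure p n) := by
    apply integral_mono
    · exact (integ_mu p n _ 1 (IA_abs p n S d)).const_mul _
    · exact integ_M p hn
    · intro x
      simp only
      unfold IA
      split_ifs with hx
      · obtain ⟨j, _, hj⟩ := hx
        rw [mul_one]
        refine le_trans ?_ (le_M p hn x j)
        gcongr
        exact hj.trans (le_abs_self _)
      · rw [mul_zero]; exact M_nonneg p n x
  rw [integral_const_mul] at h2
  calc 1 / (8 * K) * √(l * w) = √n * (d / n * (1 / (4 * K))) := by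
        rw [hd, Real.sqrt_mul hn'.le]
        have := Real.mul_self_sqrt hn'.le
        field_simp
        rw [pow_two, this]; ring
    _ ≤ √n * ∫ x, M p n x ∂(sampleMeasure p n) := by
        apply mul_le_mul_of_nonneg_left _ (Real.sqrt_nonneg _)
        refine le_trans ?_ h2
        gcongr

lemma q_add_le (p : PMF ℕ) {a b : ℕ} (h : a ≠ b) : q p a + q p b ≤ 1 := by
  have h1 : p a + p b ≤ 1 := by
    have := ENNReal.sum_le_tsum (f := p) {a, b}
    rwa [p.tsum_coe, Finset.sum_pair h] at this
  unfold q
  rw [← ENNReal.toReal_add (p.apply_ne_top a) (p.apply_ne_top b)]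
  exact ENNReal.toReal_le_of_le_ofReal zero_le_one (by simpa using h1)

lemma v_mono (p : PMF ℕ) {a b : ℕ} (h : q p b ≤ q p a) : v p b ≤ v p a := by
  by_cases hab : a = b
  · rw [hab]
  · have := q_add_le p hab
    unfold v
    nlinarith [mul_nonneg (sub_nonneg.2 h) (sub_nonneg.2 this)]

lemma cobdd (p : PMF ℕ) : IsCoboundedUnder (· ≥ ·) atTop
    (fun n : ℕ => √n * ∫ x, M p n x ∂(sampleMeasure p n)) := by
  apply IsBoundedUnder.isCoboundedUnder_ge
  refine ⟨5, ?_⟩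
  rw [eventually_map]
  filter_upwards [eventually_gt_atTop 0] with n hn
  exact upper p hn

lemma one_term (p : PMF ℕ) (e : ℕ ≃ ℕ) (h : Antitone fun i => (p (e i)).toReal) (k : ℕ) :
    1 / (8 * K) * √(v p (e k) * log ((k:ℝ) + 2)) ≤
      liminf (fun n : ℕ => √n * ∫ x, M p n x ∂(sampleMeasure p n)) atTop := by
  have hK := K_pos
  apply le_liminf_of_le (cobdd p)
  rcases (v_nonneg p (e k)).eq_or_lt with h0 | h0
  · refine Eventually.of_forall (fun n => ?_)
    rw [← h0]
    simp only [zero_mul, Real.sqrt_zero, mul_zero]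
    exact mul_nonneg (Real.sqrt_nonneg _) (integral_nonneg (M_nonneg p n))
  · set S := (Finset.range (k+1)).map e.toEmbedding with hS
    have hc : S.card = k + 1 := by simp [hS]
    filter_upwards [eventually_gt_atTop 0,
      eventually_ge_atTop ⌈(32 + log S.card) / v p (e k)⌉₊] with n hn hn2
    have hn3 : 32 + log S.card ≤ n * v p (e k) := by
      rw [← div_le_iff₀ h0]; exact Nat.ceil_le.1 hn2
    refine le_trans ?_ (M_lower p hn S (by rw [← Finset.card_pos]; omega) (v p (e k)) h0 ?_ hn3)
    · apply mul_le_mul_of_nonneg_left _ (by positivity)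
      apply Real.sqrt_le_sqrt
      rw [mul_comm]
      apply mul_le_mul_of_nonneg_right _ h0.le
      rw [hc]
      push_cast
      have hk : (0:ℝ) ≤ k := by positivity
      have h1 : log ((k:ℝ) + 2) ≤ log (2 * ((k:ℝ) + 1)) :=
        Real.log_le_log (by positivity) (by linarith)
      rw [Real.log_mul (by norm_num) (by positivity)] at h1
      have := Real.log_le_sub_one_of_pos (show (0:ℝ) < 2 by norm_num)
      linarith
    · intro j hj
      rw [hS, Finset.mem_map] at hj
      obtain ⟨i, hi, rfl⟩ := hj
      have := h (show i ≤ k by rw [Finset.mem_range] at hi; omega)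
      exact v_mono p this

end S17

/-- Proposition 7, pointwise lower bound for the MLE: there is an
absolute `c > 0` such that for every distribution `p` on `ℕ`,
`liminf_n √n · E[ sup_i |p_i - p̂_i| ] ≥ c √(V*(p))`. -/
theorem stmt_17 :
    ∃ c > (0 : ℝ), ∀ p : PMF ℕ, ∀ e : ℕ ≃ ℕ, (Antitone fun i => (p (e i)).toReal) →
      c * Real.sqrt (Vstar p e) ≤
        Filter.liminf
          (fun n : ℕ =>
            Real.sqrt n * ∫ x, (⨆ i : ℕ, |(p i).toReal - mle n x i|) ∂(sampleMeasure p n))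
          Filter.atTop := by
  have hK := S17.K_pos
  refine ⟨1 / (8 * S17.K), by positivity, ?_⟩
  intro p e h
  have H := S17.one_term p e h
  change _ ≤ Filter.liminf
    (fun n : ℕ => √n * ∫ x, S17.M p n x ∂(sampleMeasure p n)) Filter.atTop
  set l := Filter.liminf
    (fun n : ℕ => √n * ∫ x, S17.M p n x ∂(sampleMeasure p n)) Filter.atTop
  have hc : 0 < 1 / (8 * S17.K) := by positivity
  have hl : 0 ≤ l := le_trans (by positivity) (H 0)
  rw [← le_div_iff₀' hc]
  apply Real.sqrt_le_iff.2
  refine ⟨by positivity, ?_⟩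
  apply ciSup_le
  intro k
  have h2 := H k
  rw [← le_div_iff₀' hc] at h2
  exact (Real.sqrt_le_iff.1 h2).2
end
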